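/- Let G be a finite simple graph on the vertex set {1, …, n}. The following statements are equivalent: (1) I(G,w) is Cohen-Macaulay for all weight functions w; (2) I(G,w) is Buchsbaum for all weight functions w; (3) I(G,w) is generalized Cohen-Macaulay for all weight functions w; (4) I(G,w) is unmixed for all weight functions w; (5) G is the disjoint union of finitely many complete graphs. -/

import Mathlib

open CategoryTheory CategoryTheory.Limits MvPolynomial

noncomputable section

namespace SkewTab

/-! ### Partitions and skew shapes (0-indexed) -/

/-- `lam` is a partition with exactly `n` positive parts (0-indexed),
extended by `0` beyond index `n - 1`. -/
def IsPartitionFn (n : ℕ) (lam : ℕ → ℕ) : Prop :=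
  0 < n ∧ Antitone lam ∧ (∀ i, i < n → 0 < lam i) ∧ ∀ i, n ≤ i → lam i = 0

/-- `λ/μ` is a skew shape with `n` rows (0-indexed): `λ_i > μ_i ≥ 0` and `μ_n = 0`. -/
def IsSkewShape (n : ℕ) (lam mu : ℕ → ℕ) : Prop :=
  0 < n ∧ Antitone lam ∧ Antitone mu ∧ (∀ i, i < n → mu i < lam i) ∧
    (∀ i, n ≤ i → lam i = 0) ∧ mu (n - 1) = 0

/-- The conjugate partition: `conj lam j = #{i : lam i > j}` (0-indexed). -/
def conj (lam : ℕ → ℕ) (j : ℕ) : ℕ := Nat.card {i | j < lam i}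

/-- The set of boxes of the skew diagram `λ/μ` (0-indexed `(row, column)` pairs). -/
def skewDiagram (lam mu : ℕ → ℕ) : Set (ℕ × ℕ) :=
  {p | mu p.1 ≤ p.2 ∧ p.2 < lam p.1}

/-- The set of boxes of the Ferrers diagram of a partition. -/
def ferrers (nu : ℕ → ℕ) : Set (ℕ × ℕ) := {p | p.2 < nu p.1}

/-- The block of the Ferrers diagram of `nu` containing the box `p`:  blocks are the
rectangular regions cut out by the horizontal lines at the values of the conjugate
partition and the vertical lines at the values of the partition. -/
def blockOf (nu : ℕ → ℕ) (p : ℕ × ℕ) : Set (ℕ × ℕ) :=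
  {q | q.2 < nu q.1 ∧ nu q.1 = nu p.1 ∧ conj nu q.2 = conj nu p.2}

/-- A box `(i,j)` of the diagram of `nu` lies in a *corner block* iff its block has no
block to its right nor below it. -/
def InCornerBlock (nu : ℕ → ℕ) (i j : ℕ) : Prop :=
  j < nu i ∧ conj nu (nu i - 1) = conj nu j ∧ nu (conj nu j - 1) = nu i

/-- A partition is unmixed iff all its corner blocks are square
(height of the block = width of the block). -/
def IsUnmixedPartition (nu : ℕ → ℕ) : Prop :=
  (∃ n, IsPartitionFn n nu) ∧
    ∀ i j, InCornerBlock nu i j →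
      conj nu (nu i - 1) - conj nu (nu i) = nu (conj nu j - 1) - nu (conj nu j)

/-- A partition all of whose corner blocks are single boxes (1 × 1):
the condition defining prime Cohen-Macaulay shapes. -/
def IsCMPartition (nu : ℕ → ℕ) : Prop :=
  (∃ n, IsPartitionFn n nu) ∧
    ∀ i j, InCornerBlock nu i j →
      conj nu (nu i - 1) - conj nu (nu i) = 1 ∧ nu (conj nu j - 1) - nu (conj nu j) = 1

/-- A copy of (the diagram of) a partition `nu` placed in the plane.  If `upper = true`
it is placed rotated by 180° and anchored at the bottom-right position `(row, col)`
(an upper triangular shape, hugging the top-right); if `upper = false` it is placed as is,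
translated by `(row, col)` (a lower triangular shape, hugging the bottom-left). -/
structure PlacedShape where
  nu : ℕ → ℕ
  row : ℕ
  col : ℕ
  upper : Bool

/-- The embedding of the abstract diagram of `B.nu` into the plane. -/
def PlacedShape.emb (B : PlacedShape) : ℕ × ℕ → ℕ × ℕ := fun p =>
  if B.upper then (B.row - p.1, B.col - p.2) else (B.row + p.1, B.col + p.2)

/-- The set of boxes of a placed shape. -/
def PlacedShape.boxes (B : PlacedShape) : Set (ℕ × ℕ) := B.emb '' ferrers B.nu

/-- For an upper triangular placed shape the anchor must leave room for the whole
(rotated) diagram. -/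
def PlacedShape.Valid (B : PlacedShape) : Prop :=
  B.upper = true → conj B.nu 0 ≤ B.row + 1 ∧ B.nu 0 ≤ B.col + 1

/-- The two extremal blocks (top-right and bottom-left corner blocks) of a placed
shape, as subsets of the plane. -/
def PlacedShape.extremalBlocks (B : PlacedShape) : Set (Set (ℕ × ℕ)) :=
  {B.emb '' blockOf B.nu (0, B.nu 0 - 1), B.emb '' blockOf B.nu (conj B.nu 0 - 1, 0)}

/-- `D` decomposes as a union of prime shapes `B 0, …, B (t-1)` (each a placed copy of a
partition satisfying `P`), consecutive shapes being of alternating (upper/lower) type and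
intersecting exactly in a common extremal block. -/
def IsPrimeDecomposition (P : (ℕ → ℕ) → Prop) (D : Set (ℕ × ℕ)) (t : ℕ)
    (B : ℕ → PlacedShape) : Prop :=
  0 < t ∧ (∀ k, k < t → P (B k).nu ∧ (B k).Valid) ∧
    (⋃ k ∈ Set.Iio t, (B k).boxes) = D ∧
    (∀ k, k + 1 < t → (B k).upper ≠ (B (k + 1)).upper) ∧
    ∀ k, k + 1 < t →
      (B k).boxes ∩ (B (k + 1)).boxes ∈ (B k).extremalBlocks ∧
      (B k).boxes ∩ (B (k + 1)).boxes ∈ (B (k + 1)).extremalBlocks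

/-- The filling `w` is weakly increasing along both rows and columns on the boxes of `S`. -/
def WeaklyIncreasingOn (w : ℕ → ℕ → ℕ) (S : Set (ℕ × ℕ)) : Prop :=
  (∀ i j, (i, j) ∈ S → (i, j + 1) ∈ S → w i j ≤ w i (j + 1)) ∧
    ∀ i j, (i, j) ∈ S → (i + 1, j) ∈ S → w i j ≤ w (i + 1) j

/-- The filling `w` is weakly decreasing along both rows and columns on the boxes of `S`. -/
def WeaklyDecreasingOn (w : ℕ → ℕ → ℕ) (S : Set (ℕ × ℕ)) : Prop :=
  (∀ i j, (i, j) ∈ S → (i, j + 1) ∈ S → w i (j + 1) ≤ w i j) ∧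
    ∀ i j, (i, j) ∈ S → (i + 1, j) ∈ S → w (i + 1) j ≤ w i j

/-! ### Ideals and graphs attached to skew shapes -/

/-- The skew Ferrers ideal `I_{λ/μ}` in `k[x_1,…,x_n,y_1,…,y_m]`, `m = λ_1`. -/
def skewIdeal (k : Type) [Field k] (n : ℕ) (lam mu : ℕ → ℕ) :
    Ideal (MvPolynomial (Fin n ⊕ Fin (lam 0)) k) :=
  Ideal.span {q | ∃ (i : Fin n) (j : Fin (lam 0)),
    mu (i : ℕ) ≤ (j : ℕ) ∧ (j : ℕ) < lam (i : ℕ) ∧ q = X (Sum.inl i) * X (Sum.inr j)}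

/-- The skew tableau ideal `I(Y)` of the filling `w` of the skew shape `λ/μ`. -/
def tableauIdeal (k : Type) [Field k] (n : ℕ) (lam mu : ℕ → ℕ) (w : ℕ → ℕ → ℕ) :
    Ideal (MvPolynomial (Fin n ⊕ Fin (lam 0)) k) :=
  Ideal.span {q | ∃ (i : Fin n) (j : Fin (lam 0)),
    mu (i : ℕ) ≤ (j : ℕ) ∧ (j : ℕ) < lam (i : ℕ) ∧
      q = (X (Sum.inl i) * X (Sum.inr j)) ^ w (i : ℕ) (j : ℕ)}

/-- The skew tableau ideal of the skew tableau obtained from `Y` by keeping only the rows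
in `Rs` and the columns in `Cs`. -/
def tableauIdealRC (k : Type) [Field k] (n m : ℕ) (lam mu : ℕ → ℕ) (w : ℕ → ℕ → ℕ)
    (Rs : Set (Fin n)) (Cs : Set (Fin m)) : Ideal (MvPolynomial (↥Rs ⊕ ↥Cs) k) :=
  Ideal.span {q | ∃ (i : ↥Rs) (j : ↥Cs),
    mu (i.1 : ℕ) ≤ (j.1 : ℕ) ∧ (j.1 : ℕ) < lam (i.1 : ℕ) ∧
      q = (X (Sum.inl i) * X (Sum.inr j)) ^ w (i.1 : ℕ) (j.1 : ℕ)}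

/-- The skew Ferrers graph `G_{λ/μ}`, a bipartite graph on `{x_1,…,x_n} ⊔ {y_1,…,y_m}`. -/
def skewGraph (n : ℕ) (lam mu : ℕ → ℕ) : SimpleGraph (Fin n ⊕ Fin (lam 0)) :=
  SimpleGraph.fromRel fun a b => ∃ (i : Fin n) (j : Fin (lam 0)),
    mu (i : ℕ) ≤ (j : ℕ) ∧ (j : ℕ) < lam (i : ℕ) ∧ a = Sum.inl i ∧ b = Sum.inr j

/-- The edge ideal of a simple graph. -/
def edgeIdeal (k : Type) [Field k] {V : Type} (G : SimpleGraph V) :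
    Ideal (MvPolynomial V k) :=
  Ideal.span {q | ∃ u v, G.Adj u v ∧ q = X u * X v}

/-- The edge ideal of an edge-weighted simple graph. -/
def edgeIdealW (k : Type) [Field k] {V : Type} (G : SimpleGraph V) (w : V → V → ℕ) :
    Ideal (MvPolynomial V k) :=
  Ideal.span {q | ∃ u v, G.Adj u v ∧ q = (X u * X v) ^ w u v}

/-! ### Homological notions -/

/-- The homogeneous maximal ideal of a polynomial ring. -/
def maxIdeal (k : Type) [Field k] (σ : Type) : Ideal (MvPolynomial σ k) :=
  Ideal.span (Set.range (X : σ → MvPolynomial σ k))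

/-- The `i`-th local cohomology of the `R`-module `M` supported at the ideal `J`. -/
def localCoh {R : Type} [CommRing R] (J : Ideal R) (i : ℕ) (M : Type) [AddCommGroup M]
    [Module R M] : ModuleCat R :=
  (localCohomology J i).obj (ModuleCat.of R M)

/-- The Krull dimension of a module, `dim (R / ann M)`. -/
def moduleDim (R : Type) [CommRing R] (M : Type) [AddCommGroup M] [Module R M] :
    WithBot ℕ∞ :=
  ringKrullDim (R ⧸ Module.annihilator R M)

/-- A module `M` is Cohen-Macaulay (w.r.t. the maximal ideal `J`) if
`H^i_J(M) = 0` for all `i < dim M`. -/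
def IsCMModule {R : Type} [CommRing R] (J : Ideal R) (M : Type) [AddCommGroup M]
    [Module R M] : Prop :=
  ∀ i : ℕ, (i : WithBot ℕ∞) < moduleDim R M → IsZero (localCoh J i M)

/-- An ideal `I` is Cohen-Macaulay if `H^i_J(R/I) = 0` for all `i < dim R/I`
(`J` the maximal ideal). -/
def IsCMIdeal {R : Type} [CommRing R] (J I : Ideal R) : Prop :=
  ∀ i : ℕ, (i : WithBot ℕ∞) < ringKrullDim (R ⧸ I) → IsZero (localCoh J i (R ⧸ I))

/-- An ideal `I` is generalized Cohen-Macaulay if `H^i_J(R/I)` has finite length for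
all `i < dim R/I`. -/
def IsGCMIdeal {R : Type} [CommRing R] (J I : Ideal R) : Prop :=
  ∀ i : ℕ, (i : WithBot ℕ∞) < ringKrullDim (R ⧸ I) → IsFiniteLength R (localCoh J i (R ⧸ I))

/-- The canonical map `Ext^i(R/J, M) → H^i_J(M)`, i.e. the structure map of the colimit
defining local cohomology, at the first power of `J`. -/
def extToLocalCoh {R : Type} [CommRing R] (J : Ideal R) (i : ℕ) (M : ModuleCat R) :
    ((localCohomology.diagram (localCohomology.idealPowersDiagram J) i).obj
        (Opposite.op (Opposite.op (1 : ℕ)))).obj M ⟶ (localCohomology J i).obj M :=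
  have := localCohomology.hasColimitDiagram (localCohomology.idealPowersDiagram J) i
  (colimit.ι (localCohomology.diagram (localCohomology.idealPowersDiagram J) i)
    (Opposite.op (Opposite.op (1 : ℕ)))).app M

/-- An ideal `I` is Buchsbaum if the canonical map `Ext^i(R/J, R/I) → H^i_J(R/I)` is
surjective for all `i < dim R/I` (`J` the maximal ideal). -/
def IsBuchsbaumIdeal {R : Type} [CommRing R] (J I : Ideal R) : Prop :=
  ∀ i : ℕ, (i : WithBot ℕ∞) < ringKrullDim (R ⧸ I) →
    Function.Surjective (extToLocalCoh J i (ModuleCat.of R (R ⧸ I)))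

/-- An ideal `I` is unmixed if `dim R/P = dim R/I` for all associated primes `P` of `R/I`. -/
def IsUnmixedIdeal {R : Type} [CommRing R] (I : Ideal R) : Prop :=
  ∀ P ∈ associatedPrimes R (R ⧸ I), ringKrullDim (R ⧸ P) = ringKrullDim (R ⧸ I)

/-- A submodule of `S/J` (`S` a polynomial ring) is graded if it is the image of a
homogeneous ideal of `S`. -/
def IsGradedSubmodule (k σ : Type) [Field k] (J : Ideal (MvPolynomial σ k))
    (N : Submodule (MvPolynomial σ k) (MvPolynomial σ k ⧸ J)) : Prop :=
  letI := MvPolynomial.gradedAlgebra (σ := σ) (R := k)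
  ∃ K : Ideal (MvPolynomial σ k), Ideal.IsHomogeneous (homogeneousSubmodule σ k) K ∧
    ∀ x, x ∈ N ↔ x ∈ K.map (Ideal.Quotient.mk J)

/-- A (homogeneous) ideal `J` of a polynomial ring `S` is sequentially Cohen-Macaulay if
`S/J` admits a filtration `0 = M_0 ⊂ M_1 ⊂ ⋯ ⊂ M_r = S/J` by graded submodules such that
every quotient `M_{i+1}/M_i` is Cohen-Macaulay and the dimensions of the quotients are
strictly increasing. -/
def IsSCMIdeal (k σ : Type) [Field k] (J : Ideal (MvPolynomial σ k)) : Prop :=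
  ∃ (r : ℕ) (M : ℕ → Submodule (MvPolynomial σ k) (MvPolynomial σ k ⧸ J)),
    M 0 = ⊥ ∧ M r = ⊤ ∧ (∀ i, i < r → M i < M (i + 1)) ∧
    (∀ i, i ≤ r → IsGradedSubmodule k σ J (M i)) ∧
    (∀ i, i < r → IsCMModule (maxIdeal k σ)
      (↥(M (i + 1)) ⧸ Submodule.comap (M (i + 1)).subtype (M i))) ∧
    ∀ i, i + 2 ≤ r →
      moduleDim (MvPolynomial σ k)
          (↥(M (i + 1)) ⧸ Submodule.comap (M (i + 1)).subtype (M i)) <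
        moduleDim (MvPolynomial σ k)
          (↥(M (i + 2)) ⧸ Submodule.comap (M (i + 2)).subtype (M (i + 1)))

/-- A graph is sequentially Cohen-Macaulay if its edge ideal is. -/
def IsSCMGraph (k : Type) [Field k] {V : Type} (G : SimpleGraph V) : Prop :=
  IsSCMIdeal k V (edgeIdeal k G)

/-! ### Monomial ideals -/

/-- A monomial of a polynomial ring. -/
def IsMonomial {k σ : Type} [Field k] (u : MvPolynomial σ k) : Prop :=
  ∃ d : σ →₀ ℕ, u = monomial d 1

/-- A monomial ideal of a polynomial ring. -/
def IsMonomialIdeal {k σ : Type} [Field k] (I : Ideal (MvPolynomial σ k)) : Prop :=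
  ∃ T : Set (σ →₀ ℕ), I = Ideal.span ((fun d => (monomial d (1 : k) : MvPolynomial σ k)) '' T)

/-! ### Saturated partitions -/

/-- A partition is saturated if it is either strictly decreasing, or
`{λ_i, λ_i - 1, …, 1} ⊆ {λ_1, …, λ_n}` where `i` is the smallest index with
`λ_i = λ_{i+1}` (0-indexed here). -/
def IsSaturated (n : ℕ) (lam : ℕ → ℕ) : Prop :=
  StrictAntiOn lam (Set.Iio n) ∨
    ∃ i, i + 1 < n ∧ lam i = lam (i + 1) ∧ (∀ j, j < i → lam j ≠ lam (j + 1)) ∧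
      ∀ v, 0 < v → v ≤ lam i → ∃ a, a < n ∧ lam a = v

/-! ### Vertex decomposability -/

/-- A set `T` of vertices is independent in `G`. -/
def IsIndepSet {V : Type} (G : SimpleGraph V) (T : Finset V) : Prop :=
  ∀ u ∈ T, ∀ v ∈ T, ¬G.Adj u v

open Classical in
/-- The induced subgraph of `G` on a finite vertex set `A` is vertex decomposable:
either it has no edges, or it has a shredding vertex `v`, i.e. a vertex such that
`G \ v` and `G \ N[v]` are vertex decomposable and no independent set of `G \ N[v]`
is a maximal independent set of `G \ v`. -/
def IsVertexDecomposable {V : Type} (G : SimpleGraph V) : Finset V → Prop := fun A =>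
  (∀ u ∈ A, ∀ v ∈ A, ¬G.Adj u v) ∨
    ∃ v, ∃ _ : v ∈ A,
      IsVertexDecomposable G (A.erase v) ∧
      IsVertexDecomposable G (A.filter fun u => u ≠ v ∧ ¬G.Adj v u) ∧
      ∀ T ⊆ A.filter fun u => u ≠ v ∧ ¬G.Adj v u, IsIndepSet G T →
        ¬(T ⊆ A.erase v ∧ IsIndepSet G T ∧
            ∀ u ∈ A.erase v, u ∉ T → ∃ t ∈ T, G.Adj u t)
termination_by A => A.card
decreasing_by
  · exact Finset.card_erase_lt_of_mem ‹_›
  · exact Finset.card_lt_card (Finset.filter_ssubset.mpr ⟨v, ‹_›, by simp⟩)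

section Cochains

variable {R : Type} [CommRing R] {X X' Y : ModuleCat.{0} R}

/-- The map `f` is a cocycle of `Hom(P, Y)`. -/
def IsCocycle (P : ProjectiveResolution X) {i : ℕ} (f : P.complex.X i ⟶ Y) : Prop :=
  ∀ j, P.complex.d j i ≫ f = 0

/-- The map `f` is a coboundary of `Hom(P, Y)`. -/
def IsCoboundary (P : ProjectiveResolution X) {i : ℕ} (f : P.complex.X i ⟶ Y) : Prop :=
  ∃ j, ∃ g : P.complex.X j ⟶ Y, f = P.complex.d i j ≫ g

/-- The complex `Hom(P, Y)`, viewed in the opposite category. -/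
abbrev homComplex (P : ProjectiveResolution X) (Y : ModuleCat.{0} R) :
    ChainComplex (ModuleCat.{0} R)ᵒᵖ ℕ :=
  (((linearYoneda R (ModuleCat.{0} R)).obj Y).rightOp.mapHomologicalComplex _).obj P.complex

/-- The cohomology of `Hom(P, Y)` is `Ext(X, Y)`. -/
def extIso (P : ProjectiveResolution X) (Y : ModuleCat.{0} R) (i : ℕ) :
    ((homComplex P Y).homology i).unop ≅
      ((Ext R (ModuleCat.{0} R) i).obj (Opposite.op X)).obj Y :=
  (P.isoLeftDerivedObj ((linearYoneda R (ModuleCat.{0} R)).obj Y).rightOp i).unop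

/-- The map `f` is a cocycle whose class is `ξ`. -/
def Represents (P : ProjectiveResolution X) {i : ℕ} (f : P.complex.X i ⟶ Y)
    (ξ : ((Ext R (ModuleCat.{0} R) i).obj (Opposite.op X)).obj Y) : Prop :=
  ∃ z : ((homComplex P Y).opcycles i).unop,
    ((homComplex P Y).pOpcycles i).unop z = f ∧
      (extIso P Y i).hom (((homComplex P Y).homologyι i).unop z) = ξ

lemma Represents.smul {P : ProjectiveResolution X} {i : ℕ} {f : P.complex.X i ⟶ Y}
    {ξ : ((Ext R (ModuleCat.{0} R) i).obj (Opposite.op X)).obj Y} (h : Represents P f ξ)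
    (a : R) : Represents P (a • f) (a • ξ) := by
  obtain ⟨z, rfl, rfl⟩ := h
  exact ⟨a • z, map_smul (((homComplex P Y).pOpcycles i).unop.hom) a z, by
    rw [map_smul, map_smul]⟩

lemma exists_represents (P : ProjectiveResolution X) {i : ℕ}
    (ξ : ((Ext R (ModuleCat.{0} R) i).obj (Opposite.op X)).obj Y) :
    ∃ f : P.complex.X i ⟶ Y, Represents P f ξ := by
  obtain ⟨h, rfl⟩ := (ModuleCat.epi_iff_surjective (extIso P Y i).hom).1 inferInstance ξ
  obtain ⟨z, rfl⟩ := (ModuleCat.epi_iff_surjective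
    ((homComplex P Y).homologyι i).unop).1 inferInstance h
  exact ⟨_, z, rfl, rfl⟩

lemma Represents.isCocycle {P : ProjectiveResolution X} {i : ℕ} {f : P.complex.X i ⟶ Y}
    {ξ : ((Ext R (ModuleCat.{0} R) i).obj (Opposite.op X)).obj Y} (h : Represents P f ξ) :
    IsCocycle P f := by
  obtain ⟨z, rfl, rfl⟩ := h
  intro j
  have := (homComplex P Y).d_pOpcycles j i
  have h2 := congrArg (fun q => q.unop z) this
  exact h2

lemma IsCocycle.exists_represents {P : ProjectiveResolution X} {i : ℕ}
    {f : P.complex.X i ⟶ Y} (hf : IsCocycle P f) : ∃ ξ, Represents P f ξ := by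
  have := (ShortComplex.mk _ _ ((homComplex P Y).d_pOpcycles (i+1) i)).exact_of_g_is_cokernel
    ((homComplex P Y).opcyclesIsCokernel (i+1) i (by simp))
  have h2 := this.unop
  rw [ShortComplex.moduleCat_exact_iff] at h2
  obtain ⟨z, hz⟩ := h2 f (hf (i + 1))
  exact ⟨_, z, hz, rfl⟩

lemma Represents.eq_zero_iff {P : ProjectiveResolution X} {i : ℕ} {f : P.complex.X i ⟶ Y}
    {ξ : ((Ext R (ModuleCat.{0} R) i).obj (Opposite.op X)).obj Y} (h : Represents P f ξ) :
    ξ = 0 ↔ IsCoboundary P f := by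
  obtain ⟨z, rfl, rfl⟩ := h
  have hE : (ShortComplex.mk _ _ ((homComplex P Y).homologyι_comp_fromOpcycles i
      ((ComplexShape.down ℕ).next i))).Exact :=
    ShortComplex.exact_of_f_is_kernel _ ((homComplex P Y).homologyIsKernel i _ rfl)
  have h2 := hE.unop
  rw [ShortComplex.moduleCat_exact_iff] at h2
  have h3 := (homComplex P Y).p_fromOpcycles i ((ComplexShape.down ℕ).next i)
  constructor
  · intro h0
    have : ((homComplex P Y).homologyι i).unop z = 0 := by
      apply (ModuleCat.mono_iff_injective (extIso P Y i).hom).1 inferInstance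
      rw [h0, map_zero]
    obtain ⟨g, hg⟩ := h2 z this
    refine ⟨_, g, ?_⟩
    rw [← hg]
    exact congrArg (fun q => q.unop g) h3
  · rintro ⟨j, g, hg⟩
    have hz : z = ((homComplex P Y).fromOpcycles i j).unop g := by
      apply (ModuleCat.mono_iff_injective ((homComplex P Y).pOpcycles i).unop).1 inferInstance
      rw [hg]
      exact (congrArg (fun q => q.unop g) ((homComplex P Y).p_fromOpcycles i j)).symm
    have h4 := congrArg (fun q => q.unop g) ((homComplex P Y).homologyι_comp_fromOpcycles i j)
    have h5 : ((homComplex P Y).homologyι i).unop z = 0 := by rw [hz]; exact h4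
    rw [h5, map_zero]

lemma Represents.map {P : ProjectiveResolution X} {P' : ProjectiveResolution X'} {i : ℕ}
    {f : P.complex.X i ⟶ Y}
    {ξ : ((Ext R (ModuleCat.{0} R) i).obj (Opposite.op X)).obj Y} (h : Represents P f ξ)
    (φ : X' ⟶ X) (Φ : P'.complex ⟶ P.complex)
    (hΦ : Φ.f 0 ≫ P.π.f 0 = P'.π.f 0 ≫ ((ChainComplex.single₀ _).map φ).f 0) :
    Represents P' (Φ.f i ≫ f) (((Ext R (ModuleCat.{0} R) i).map φ.op).app Y ξ) := by
  obtain ⟨z, rfl, rfl⟩ := h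
  let F := ((linearYoneda R (ModuleCat.{0} R)).obj Y).rightOp
  let Ψ : homComplex P' Y ⟶ homComplex P Y := (F.mapHomologicalComplex _).map Φ
  refine ⟨(HomologicalComplex.opcyclesMap Ψ i).unop z, ?_, ?_⟩
  · exact (congrArg (fun q => q.unop z) (HomologicalComplex.p_opcyclesMap Ψ i))
  · have h1 := ProjectiveResolution.isoLeftDerivedObj_hom_naturality φ P' P Φ hΦ F i
    have h2 := HomologicalComplex.homologyι_naturality Ψ i
    have h3 := (congrArg (fun q => q.unop z) h2)
    have h4 := congrArg (fun q => q.unop (((homComplex P Y).homologyι i).unop z)) h1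
    refine Eq.trans ?_ h4.symm
    exact congrArg (extIso P' Y i).hom h3.symm

end Cochains

section LongExact

variable {R : Type} [CommRing R] {X X' Y : ModuleCat.{0} R}

lemma IsCoboundary.smul {P : ProjectiveResolution X} {i : ℕ} {f : P.complex.X i ⟶ Y}
    (h : IsCoboundary P f) (a : R) : IsCoboundary P (a • f) := by
  obtain ⟨j, g, rfl⟩ := h
  exact ⟨j, a • g, by simp⟩

lemma IsCocycle.smul {P : ProjectiveResolution X} {i : ℕ} {f : P.complex.X i ⟶ Y}
    (h : IsCocycle P f) (a : R) : IsCocycle P (a • f) := fun j => by simp [h j]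

lemma IsCocycle.comp {P : ProjectiveResolution X} {i : ℕ} {f : P.complex.X i ⟶ Y}
    (h : IsCocycle P f) {Z : ModuleCat.{0} R} (g : Y ⟶ Z) : IsCocycle P (f ≫ g) := fun j => by
  rw [reassoc_of% (h j), zero_comp]

lemma IsCocycle.map {P : ProjectiveResolution X} {P' : ProjectiveResolution X'} {i : ℕ}
    {f : P.complex.X i ⟶ Y} (h : IsCocycle P f) (Φ : P'.complex ⟶ P.complex) :
    IsCocycle P' (Φ.f i ≫ f) := fun j => by
  rw [← Φ.comm_assoc, h j, comp_zero]

lemma IsCoboundary.map {P : ProjectiveResolution X} {P' : ProjectiveResolution X'} {i : ℕ}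
    {f : P.complex.X i ⟶ Y} (h : IsCoboundary P f) (Φ : P'.complex ⟶ P.complex) :
    IsCoboundary P' (Φ.f i ≫ f) := by
  obtain ⟨j, g, rfl⟩ := h
  exact ⟨j, Φ.f j ≫ g, by rw [Φ.comm_assoc]⟩

lemma IsCocycle.isCoboundary_smul {P : ProjectiveResolution X} {i : ℕ} {f : P.complex.X i ⟶ Y}
    (hf : IsCocycle P f) {a : R} (ha : a • 𝟙 X = 0) : IsCoboundary P (a • f) := by
  have hc : (a • 𝟙 P.complex) ≫ P.π = 0 := by
    apply HomologicalComplex.to_single_hom_ext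
    have : P.π.f 0 ≫ (a • 𝟙 _) = 0 := by
      rw [show (a • 𝟙 (((ChainComplex.single₀ (ModuleCat.{0} R)).obj X).X 0)) = 0 from ha,
        comp_zero]
    rw [Linear.comp_smul, Category.comp_id] at this
    simpa using this
  have H := (ProjectiveResolution.liftHomotopyZero _ hc).comm i
  have H2 : a • f = (a • 𝟙 P.complex : P.complex ⟶ P.complex).f i ≫ f := by simp
  rw [H2, H]
  refine ⟨(ComplexShape.down ℕ).next i, (ProjectiveResolution.liftHomotopyZero _ hc).hom _ _ ≫ f,
    ?_⟩
  simp [dNext, prevD, hf _]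

/-- All cocycles in degree `i` are coboundaries. -/
def ExtVanishes (P : ProjectiveResolution X) (i : ℕ) (Y : ModuleCat.{0} R) : Prop :=
  ∀ f : P.complex.X i ⟶ Y, IsCocycle P f → IsCoboundary P f

lemma d_eq_zero_or {P : ProjectiveResolution X} (i j : ℕ) : j + 1 = i ∨ P.complex.d i j = 0 := by
  by_cases h : j + 1 = i
  · exact Or.inl h
  · exact Or.inr (P.complex.shape _ _ (by simpa using h))

lemma extVanishes_of_regular {P : ProjectiveResolution X} {i : ℕ} {M N : ModuleCat.{0} R}
    {x : R} {π : M ⟶ N} (w : (x • 𝟙 M) ≫ π = 0) (hS : (ShortComplex.mk _ _ w).ShortExact)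
    {n : ℕ} (hn : x ^ n • 𝟙 X = 0) (hN : ∀ k, k + 1 = i → ExtVanishes P k N) :
    ExtVanishes P i M := by
  have := hS.mono_f
  have := hS.epi_g
  have step : ∀ f : P.complex.X i ⟶ M, IsCocycle P f → IsCoboundary P (x • f) →
      IsCoboundary P f := by
    rintro f hf ⟨j, g, hg⟩
    rcases d_eq_zero_or (P := P) i j with rfl | h0
    · have hgc : IsCocycle P (g ≫ π) := fun k => by
        rcases d_eq_zero_or (P := P) k j with rfl | h0
        · rw [← Category.assoc, ← hg]
          have : f ≫ (x • 𝟙 M) ≫ π = 0 := by rw [w, comp_zero]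
          simpa using this
        · rw [h0, zero_comp]
      obtain ⟨l, h, hh⟩ := hN j rfl _ hgc
      let h' : P.complex.X l ⟶ M := Projective.factorThru h π
      have hz : (g - P.complex.d j l ≫ h') ≫ π = 0 := by
        simp [h', hh]
      let g' := hS.exact.lift _ hz
      have hg' : g' ≫ (x • 𝟙 M) = g - P.complex.d j l ≫ h' := hS.exact.lift_f _ hz
      refine ⟨j, g', ?_⟩
      rw [← cancel_mono (x • 𝟙 M), Category.assoc, hg']
      simpa using hg
    · refine ⟨j, 0, ?_⟩
      rw [← cancel_mono (x • 𝟙 M)]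
      simpa [h0] using hg
  have key : ∀ n, ∀ f : P.complex.X i ⟶ M, IsCocycle P f → IsCoboundary P (x ^ n • f) →
      IsCoboundary P f := by
    intro n
    induction n with
    | zero => intro f _ h; simpa using h
    | succ n ih =>
      intro f hf h
      apply ih f hf
      apply step _ (hf.smul _)
      rwa [smul_smul, ← pow_succ']
  exact fun f hf => key n f hf (hf.isCoboundary_smul hn)

variable (J : Ideal R)

/-- The module `R / J ^ t`. -/
abbrev quotPow (t : ℕ) : ModuleCat.{0} R := ModuleCat.of R (R ⧸ J ^ t)

/-- The projection `R / J ^ t' → R / J ^ t` for `t ≤ t'`. -/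
def quotPowMap {t t' : ℕ} (h : t ≤ t') : quotPow J t' ⟶ quotPow J t :=
  ModuleCat.ofHom (Submodule.mapQ _ _ LinearMap.id (Ideal.pow_le_pow_right h))

lemma quotPowMap_comp {t t' t'' : ℕ} (h : t ≤ t') (h' : t' ≤ t'') :
    quotPowMap J h' ≫ quotPowMap J h = quotPowMap J (h.trans h') := by
  ext
  rfl

/-- A chain map between resolutions lifts a given map. -/
def IsLift {P' : ProjectiveResolution X'} {P : ProjectiveResolution X} (φ : X' ⟶ X)
    (Φ : P'.complex ⟶ P.complex) : Prop :=
  Φ.f 0 ≫ P.π.f 0 = P'.π.f 0 ≫ ((ChainComplex.single₀ (ModuleCat.{0} R)).map φ).f 0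

lemma IsLift.comp {X'' : ModuleCat.{0} R} {P'' : ProjectiveResolution X''}
    {P' : ProjectiveResolution X'} {P : ProjectiveResolution X} {φ : X' ⟶ X} {ψ : X'' ⟶ X'}
    {Φ : P'.complex ⟶ P.complex} {Ψ : P''.complex ⟶ P'.complex}
    (h : IsLift φ Φ) (h' : IsLift ψ Ψ) : IsLift (ψ ≫ φ) (Ψ ≫ Φ) := by
  unfold IsLift at *
  rw [HomologicalComplex.comp_f, Category.assoc, h, reassoc_of% h', Functor.map_comp,
    HomologicalComplex.comp_f]

lemma isLift_lift (Q : ProjectiveResolution X') (P : ProjectiveResolution X) (φ : X' ⟶ X) :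
    IsLift φ (ProjectiveResolution.lift φ Q P) :=
  HomologicalComplex.congr_hom (ProjectiveResolution.lift_commutes φ Q P) 0

/-- The element `a` annihilates the `i`-th local cohomology of `M` with support in `J`,
expressed through cocycles on projective resolutions. -/
def CohKilledBy (a : R) (i : ℕ) (M : ModuleCat.{0} R) : Prop :=
  ∀ (t : ℕ) (P : ProjectiveResolution (quotPow J t)) (f : P.complex.X i ⟶ M), IsCocycle P f →
    ∃ (t' : ℕ) (ht : t ≤ t') (P' : ProjectiveResolution (quotPow J t'))
      (Φ : P'.complex ⟶ P.complex), IsLift (quotPowMap J ht) Φ ∧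
        IsCoboundary P' (a • (Φ.f i ≫ f))

variable {J}

lemma CohKilledBy.of_shortExact {a b : R} {i : ℕ} {S : ShortComplex (ModuleCat.{0} R)}
    (hS : S.ShortExact) (h₂ : CohKilledBy J b i S.X₂)
    (h₃ : ∀ k, k + 1 = i → CohKilledBy J a k S.X₃) : CohKilledBy J (a * b) i S.X₁ := by
  have := hS.mono_f
  have := hS.epi_g
  intro t P f hf
  obtain ⟨t', ht, P', Φ, hΦ, j, g, hg⟩ := h₂ t P (f ≫ S.f) (hf.comp _)
  rcases d_eq_zero_or (P := P') i j with rfl | h0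
  · have hgc : IsCocycle P' (g ≫ S.g) := fun k => by
      rcases d_eq_zero_or (P := P') k j with rfl | h0
      · rw [← Category.assoc, ← hg]
        simp
      · rw [h0, zero_comp]
    obtain ⟨t'', ht', P'', Ψ, hΨ, l, h, hh⟩ := h₃ j rfl t' P' _ hgc
    let h' : P''.complex.X l ⟶ S.X₂ := Projective.factorThru h S.g
    have hz : (a • (Ψ.f j ≫ g) - P''.complex.d j l ≫ h') ≫ S.g = 0 := by
      simp only [Preadditive.sub_comp, Linear.smul_comp, Category.assoc, hh, h',
        Projective.factorThru_comp, sub_self]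
    let g' := hS.exact.lift _ hz
    have hg' : g' ≫ S.f = a • (Ψ.f j ≫ g) - P''.complex.d j l ≫ h' := hS.exact.lift_f _ hz
    refine ⟨t'', ht.trans ht', P'', Ψ ≫ Φ, ?_, j, g', ?_⟩
    · rw [← quotPowMap_comp J ht ht']
      exact hΦ.comp hΨ
    · rw [← cancel_mono S.f, Category.assoc, hg', Preadditive.comp_sub,
        HomologicalComplex.d_comp_d_assoc, zero_comp, sub_zero, Linear.comp_smul,
        ← Ψ.comm_assoc, ← hg, mul_smul]
      simp
  · refine ⟨t', ht, P', Φ, hΦ, j, 0, ?_⟩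
    rw [← cancel_mono S.f, mul_smul, Linear.smul_comp]
    have : (b • Φ.f i ≫ f) ≫ S.f = 0 := by
      simpa [h0] using hg
    rw [this]
    simp

lemma CohKilledBy.of_regular {b x : R} {i : ℕ} {M N : ModuleCat.{0} R} {π : M ⟶ N}
    (w : (x • 𝟙 M) ≫ π = 0) (hS : (ShortComplex.mk _ _ w).ShortExact)
    (hM : ∀ (t : ℕ) (P : ProjectiveResolution (quotPow J t)), ExtVanishes P i M)
    (h : CohKilledBy J b (i + 1) M) : CohKilledBy J b i N := by
  have := hS.mono_f
  have := hS.epi_g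
  intro t P f hf
  let f' : P.complex.X i ⟶ M := Projective.factorThru f π
  have hf' : f' ≫ π = f := Projective.factorThru_comp _ _
  have hz : (P.complex.d (i + 1) i ≫ f') ≫ π = 0 := by rw [Category.assoc, hf', hf]
  let g := hS.exact.lift _ hz
  have hg : g ≫ (x • 𝟙 M) = P.complex.d (i + 1) i ≫ f' := hS.exact.lift_f _ hz
  have hgc : IsCocycle P g := fun k => by
    rw [← cancel_mono (x • 𝟙 M), Category.assoc, hg]
    simp
  obtain ⟨t', ht, P', Φ, hΦ, j, u, hu⟩ := h t P g hgc
  refine ⟨t', ht, P', Φ, hΦ, ?_⟩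
  obtain ⟨h', hh'⟩ : ∃ h' : P'.complex.X i ⟶ M,
      b • (Φ.f (i + 1) ≫ g) = P'.complex.d (i + 1) i ≫ h' := by
    rcases d_eq_zero_or (P := P') (i + 1) j with hj | h0
    · obtain rfl : j = i := by omega
      exact ⟨u, hu⟩
    · exact ⟨0, by simp [hu, h0]⟩
  have hc : IsCocycle P' (x • h' - b • (Φ.f i ≫ f')) := fun k => by
    rcases d_eq_zero_or (P := P') k i with rfl | h0
    · rw [Preadditive.comp_sub, Linear.comp_smul, Linear.comp_smul, ← hh', ← Φ.comm_assoc, ← hg]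
      simp [smul_smul, mul_comm]
    · rw [h0, zero_comp]
  obtain ⟨l, q, hq⟩ := hM t' P' _ hc
  refine ⟨l, -(q ≫ π), ?_⟩
  have h1 : (x • h') ≫ π = 0 := by
    have : h' ≫ (x • 𝟙 M) ≫ π = 0 := by rw [w, comp_zero]
    simpa using this
  have h2 := congrArg (fun u => u ≫ π) hq
  simp only [Preadditive.sub_comp, h1, zero_sub, Linear.smul_comp, Category.assoc, hf'] at h2
  rw [Preadditive.comp_neg, ← h2, neg_neg]

lemma CohKilledBy.smul_eq_zero {b : R} {N : ModuleCat.{0} R} (h : CohKilledBy J b 0 N) {t : ℕ}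
    (q : quotPow J t ⟶ N) : b • q = 0 := by
  let P := ProjectiveResolution.of (quotPow J t)
  let q₀ : ((ChainComplex.single₀ (ModuleCat.{0} R)).obj (quotPow J t)).X 0 ⟶ N := q
  obtain ⟨t', ht, P', Φ, hΦ, j, g, hg⟩ := h t P (P.π.f 0 ≫ q₀) (fun k => by
    rcases d_eq_zero_or (P := P) k 0 with rfl | h0
    · exact (Category.assoc _ _ _).symm.trans
        ((congrArg (· ≫ q₀) P.complex_d_comp_π_f_zero).trans zero_comp)
    · rw [h0, zero_comp])
  have h0 : P'.complex.d 0 j = 0 := P'.complex.shape _ _ (by simp)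
  have e1 : Epi (quotPowMap J ht) := by
    rw [ModuleCat.epi_iff_surjective]
    intro x
    obtain ⟨x, rfl⟩ := Ideal.Quotient.mk_surjective x
    exact ⟨Ideal.Quotient.mk _ x, rfl⟩
  rw [h0, zero_comp, reassoc_of% hΦ] at hg
  have hg' : b • (((ChainComplex.single₀ (ModuleCat.{0} R)).map (quotPowMap J ht)).f 0 ≫ q₀) =
      0 := by
    rw [← cancel_epi (P'.π.f 0), Linear.comp_smul, hg, comp_zero]
  rw [← cancel_epi (quotPowMap J ht), comp_zero, Linear.comp_smul]
  exact hg'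

end LongExact

section LocalCohomology

variable {R : Type} [CommRing R] (J : Ideal R) (i : ℕ) (M : ModuleCat.{0} R)

/-- The directed system `Ext^i(R / J ^ t, M)`. -/
abbrev extSystem : (ℕᵒᵖ)ᵒᵖ ⥤ ModuleCat.{0} R :=
  localCohomology.diagram (localCohomology.idealPowersDiagram J) i ⋙
    (evaluation (ModuleCat.{0} R) (ModuleCat.{0} R)).obj M

instance : HasColimit (localCohomology.diagram (localCohomology.idealPowersDiagram J) i) :=
  localCohomology.hasColimitDiagram _ i

/-- Local cohomology as a cocone over `extSystem`. -/
abbrev extCocone : Cocone (extSystem J i M) :=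
  ((evaluation (ModuleCat.{0} R) (ModuleCat.{0} R)).obj M).mapCocone
    (colimit.cocone (localCohomology.diagram (localCohomology.idealPowersDiagram J) i))

/-- Local cohomology is the colimit of `extSystem`. -/
def extCoconeIsColimit : IsColimit (extCocone J i M) :=
  isColimitOfPreserves _ (colimit.isColimit _)

/-- The structure map `Ext^i(R / J ^ t, M) → H^i_J(M)`. -/
def extι (t : ℕ) : ((Ext R (ModuleCat.{0} R) i).obj (Opposite.op (quotPow J t))).obj M ⟶
    (localCohomology J i).obj M :=
  (extCocone J i M).ι.app (Opposite.op (Opposite.op t))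

lemma exists_extι_eq (x : (localCohomology J i).obj M) : ∃ t ξ, extι J i M t ξ = x := by
  obtain ⟨⟨⟨t⟩⟩, ξ, h⟩ := Concrete.isColimit_exists_rep _ (extCoconeIsColimit J i M) x
  exact ⟨t, ξ, h⟩

variable {J i M}

lemma exists_map_eq_zero {t : ℕ}
    {ξ : ((Ext R (ModuleCat.{0} R) i).obj (Opposite.op (quotPow J t))).obj M}
    (h : extι J i M t ξ = 0) : ∃ (t' : ℕ) (ht : t ≤ t'),
      ((Ext R (ModuleCat.{0} R) i).map (quotPowMap J ht).op).app M ξ = 0 := by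
  obtain ⟨⟨⟨t'⟩⟩, f, g, hfg⟩ := Concrete.isColimit_exists_of_rep_eq (F := extSystem J i M)
    (i := Opposite.op (Opposite.op t)) (j := Opposite.op (Opposite.op t))
    (extCoconeIsColimit J i M) ξ 0 (h.trans (map_zero (extι J i M t).hom).symm)
  refine ⟨t', leOfHom f.unop.unop, ?_⟩
  refine Eq.trans ?_ (hfg.trans (map_zero ((extSystem J i M).map g).hom))
  rfl

lemma cohKilledBy_of_smul_eq_zero {b : R}
    (h : ∀ x : (localCohomology J i).obj M, b • x = 0) : CohKilledBy J b i M := by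
  intro t P f hf
  obtain ⟨ξ, hξ⟩ := hf.exists_represents
  obtain ⟨t', ht, h0⟩ := exists_map_eq_zero (J := J) (i := i) (M := M) (ξ := b • ξ)
    (by rw [map_smul, h])
  let P' := ProjectiveResolution.of (quotPow J t')
  let Φ := ProjectiveResolution.lift (quotPowMap J ht) P' P
  refine ⟨t', ht, P', Φ, isLift_lift _ _ _, ?_⟩
  have := (hξ.smul b).map (quotPowMap J ht) Φ (isLift_lift _ _ _)
  have := this.eq_zero_iff.1 h0
  simpa using this

lemma smul_ext_eq_zero {b : R} {t : ℕ} (hb : b ∈ J ^ t)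
    (ξ : ((Ext R (ModuleCat.{0} R) i).obj (Opposite.op (quotPow J t))).obj M) : b • ξ = 0 := by
  obtain ⟨f, hf⟩ := exists_represents (ProjectiveResolution.of (quotPow J t)) ξ
  refine (hf.smul b).eq_zero_iff.2 (hf.isCocycle.isCoboundary_smul ?_)
  ext
  change b • (Ideal.Quotient.mk (J ^ t) 1) = 0
  rw [← Ideal.Quotient.mk_eq_mk, ← Submodule.Quotient.mk_smul, smul_eq_mul, mul_one]
  exact (Submodule.Quotient.mk_eq_zero _).2 hb

lemma isZero_localCohomology
    (h : ∀ (t : ℕ) (P : ProjectiveResolution (quotPow J t)), ExtVanishes P i M) :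
    IsZero ((localCohomology J i).obj M) := by
  have : Subsingleton ((localCohomology J i).obj M) := by
    refine subsingleton_of_forall_eq 0 fun x => ?_
    obtain ⟨t, ξ, rfl⟩ := exists_extι_eq J i M x
    obtain ⟨f, hf⟩ := exists_represents (ProjectiveResolution.of (quotPow J t)) ξ
    rw [hf.eq_zero_iff.2 (h _ _ _ hf.isCocycle), map_zero]
  exact ModuleCat.isZero_of_subsingleton _

lemma exists_pow_smul_eq_zero (h : IsFiniteLength R ((localCohomology J i).obj M)) {z : R}
    (hz : z ∈ J) : ∃ s, ∀ x : (localCohomology J i).obj M, z ^ s • x = 0 := by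
  rw [isFiniteLength_iff_isNoetherian_isArtinian] at h
  have := h.1
  obtain ⟨s, hs⟩ := (inferInstance : Module.Finite R ((localCohomology J i).obj M)).fg_top
  have key : ∀ x : (localCohomology J i).obj M, ∃ t, z ^ t • x = 0 := fun x => by
    obtain ⟨t, ξ, rfl⟩ := exists_extι_eq J i M x
    exact ⟨t, by rw [← map_smul, smul_ext_eq_zero (Ideal.pow_mem_pow hz t), map_zero]⟩
  choose t ht using key
  refine ⟨s.sup t, fun x => ?_⟩
  have hx : x ∈ Submodule.span R (s : Set ((localCohomology J i).obj M)) := hs ▸ trivial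
  induction hx using Submodule.span_induction with
  | mem x hx =>
    rw [← Nat.sub_add_cancel (Finset.le_sup (f := t) hx), pow_add, mul_smul, ht, smul_zero]
  | zero => simp
  | add x y _ _ hx hy => rw [smul_add, hx, hy, add_zero]
  | smul a x _ hx => rw [smul_comm, hx, smul_zero]

end LocalCohomology

section CohKilledBy

variable {R : Type} [CommRing R] {J I : Ideal R} {z : R} {i : ℕ}

lemma IsCMIdeal.exists_cohKilledBy (h : IsCMIdeal J I)
    (hi : (i : WithBot ℕ∞) < ringKrullDim (R ⧸ I)) :
    ∃ s, CohKilledBy J (z ^ s) i (ModuleCat.of R (R ⧸ I)) := by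
  refine ⟨0, cohKilledBy_of_smul_eq_zero fun x => ?_⟩
  have := ModuleCat.subsingleton_of_isZero (h i hi)
  exact Subsingleton.elim (α := localCoh J i (R ⧸ I)) _ _

lemma IsGCMIdeal.exists_cohKilledBy (h : IsGCMIdeal J I) (hz : z ∈ J)
    (hi : (i : WithBot ℕ∞) < ringKrullDim (R ⧸ I)) :
    ∃ s, CohKilledBy J (z ^ s) i (ModuleCat.of R (R ⧸ I)) := by
  obtain ⟨s, hs⟩ := exists_pow_smul_eq_zero (h i hi) hz
  exact ⟨s, cohKilledBy_of_smul_eq_zero hs⟩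

lemma IsBuchsbaumIdeal.exists_cohKilledBy (h : IsBuchsbaumIdeal J I) (hz : z ∈ J)
    (hi : (i : WithBot ℕ∞) < ringKrullDim (R ⧸ I)) :
    ∃ s, CohKilledBy J (z ^ s) i (ModuleCat.of R (R ⧸ I)) := by
  refine ⟨1, cohKilledBy_of_smul_eq_zero fun x => ?_⟩
  obtain ⟨ξ, rfl⟩ := h i hi x
  rw [← map_smul]
  have h0 := smul_ext_eq_zero (J := J) (i := i) (M := ModuleCat.of R (R ⧸ I))
    (Ideal.pow_mem_pow hz 1) ξ
  exact (congrArg _ h0).trans (map_zero (extToLocalCoh J i (ModuleCat.of R (R ⧸ I))).hom)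

end CohKilledBy

section IdealSequences

variable {R : Type} [CommRing R] {J I I' I'' : Ideal R} {a : R} {i : ℕ}

lemma CohKilledBy.of_colon {x y : R} (h' : ∀ f, a * f ∈ I ↔ f ∈ I')
    (hI'' : I'' = I ⊔ Ideal.span {a}) (h₂ : CohKilledBy J y i (ModuleCat.of R (R ⧸ I)))
    (h₃ : ∀ k, k + 1 = i → CohKilledBy J x k (ModuleCat.of R (R ⧸ I''))) :
    CohKilledBy J (x * y) i (ModuleCat.of R (R ⧸ I')) := by
  let f : (R ⧸ I') →ₗ[R] (R ⧸ I) := Submodule.mapQ I' I (LinearMap.mulLeft R a)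
    fun f hf => (h' f).2 hf
  let g : (R ⧸ I) →ₗ[R] (R ⧸ I'') := Submodule.mapQ I I'' LinearMap.id
    (hI'' ▸ le_sup_left)
  have hf (r : R) : f (Submodule.Quotient.mk r) = Submodule.Quotient.mk (a * r) := rfl
  have hg (r : R) : g (Submodule.Quotient.mk r) = Submodule.Quotient.mk r := rfl
  have hmem (r : R) : r ∈ I'' ↔ ∃ q, r - a * q ∈ I := by
    rw [hI'', Submodule.mem_sup]
    constructor
    · rintro ⟨u, hu, v, hv, rfl⟩
      obtain ⟨q, rfl⟩ := Ideal.mem_span_singleton'.1 hv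
      exact ⟨q, by rwa [mul_comm, add_sub_cancel_right]⟩
    · rintro ⟨q, hq⟩
      exact ⟨_, hq, a * q, Ideal.mem_span_singleton.2 ⟨q, rfl⟩, by ring⟩
  have w : ModuleCat.ofHom f ≫ ModuleCat.ofHom g = 0 := by
    ext
    change g (f (Submodule.Quotient.mk 1)) = 0
    rw [hf, hg, Submodule.Quotient.mk_eq_zero, hmem]
    exact ⟨1, by simp⟩
  have hS : (ShortComplex.mk _ _ w).ShortExact :=
    { exact := by
        rw [ShortComplex.moduleCat_exact_iff]
        intro y hy
        obtain ⟨y, rfl⟩ := Submodule.Quotient.mk_surjective I y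
        obtain ⟨q, hq⟩ := (hmem y).1 ((Submodule.Quotient.mk_eq_zero _).1 hy)
        refine ⟨Submodule.Quotient.mk q, ?_⟩
        symm
        exact (Submodule.Quotient.eq I).2 hq
      mono_f := by
        rw [ModuleCat.mono_iff_injective]
        change Function.Injective f
        rw [injective_iff_map_eq_zero]
        intro r hr
        obtain ⟨r, rfl⟩ := Submodule.Quotient.mk_surjective I' r
        rw [hf, Submodule.Quotient.mk_eq_zero] at hr
        exact (Submodule.Quotient.mk_eq_zero _).2 ((h' r).1 hr)
      epi_g := by
        rw [ModuleCat.epi_iff_surjective]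
        intro r
        obtain ⟨r, rfl⟩ := Submodule.Quotient.mk_surjective I'' r
        exact ⟨Submodule.Quotient.mk r, rfl⟩ }
  exact CohKilledBy.of_shortExact hS h₂ h₃

/-- The projection `R / I → R / (I + (a))`. -/
def quotProj (I : Ideal R) (a : R) :
    ModuleCat.of R (R ⧸ I) ⟶ ModuleCat.of R (R ⧸ (I ⊔ Ideal.span {a})) :=
  ModuleCat.ofHom (Submodule.mapQ I (I ⊔ Ideal.span {a}) LinearMap.id le_sup_left)

lemma smul_comp_quotProj : (a • 𝟙 (ModuleCat.of R (R ⧸ I))) ≫ quotProj I a = 0 := by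
  ext
  change (Submodule.Quotient.mk (a * 1) : R ⧸ (I ⊔ Ideal.span {a})) = 0
  rw [Submodule.Quotient.mk_eq_zero, mul_one]
  exact Ideal.mem_sup_right (Ideal.mem_span_singleton_self a)

lemma shortExact_quotProj (h : ∀ f, a * f ∈ I → f ∈ I) :
    (ShortComplex.mk _ _ (smul_comp_quotProj (I := I) (a := a))).ShortExact where
  exact := by
    rw [ShortComplex.moduleCat_exact_iff]
    intro y hy
    obtain ⟨y, rfl⟩ := Submodule.Quotient.mk_surjective I y
    obtain ⟨u, hu, v, hv, rfl⟩ := Submodule.mem_sup.1 ((Submodule.Quotient.mk_eq_zero _).1 hy)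
    obtain ⟨q, rfl⟩ := Ideal.mem_span_singleton'.1 hv
    refine ⟨Submodule.Quotient.mk q, ?_⟩
    change Submodule.Quotient.mk (a * q) = _
    exact (Submodule.Quotient.eq I).2 (by convert I.neg_mem hu using 1; ring)
  mono_f := by
    rw [ModuleCat.mono_iff_injective]
    change Function.Injective (fun r : R ⧸ I => a • r)
    intro r s hrs
    obtain ⟨r, rfl⟩ := Submodule.Quotient.mk_surjective I r
    obtain ⟨s, rfl⟩ := Submodule.Quotient.mk_surjective I s
    refine (Submodule.Quotient.eq I).2 (h _ ?_)
    rw [mul_sub]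
    exact (Submodule.Quotient.eq I).1 hrs
  epi_g := by
    rw [ModuleCat.epi_iff_surjective]
    intro r
    obtain ⟨r, rfl⟩ := Submodule.Quotient.mk_surjective _ r
    exact ⟨Submodule.Quotient.mk r, rfl⟩

lemma pow_smul_id_quotPow {t : ℕ} (ha : a ∈ J) : a ^ t • 𝟙 (quotPow J t) = 0 := by
  ext
  change (Submodule.Quotient.mk (a ^ t * 1) : R ⧸ J ^ t) = 0
  rw [Submodule.Quotient.mk_eq_zero, mul_one]
  exact Ideal.pow_mem_pow ha t

end IdealSequences

section MonomialIdeals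

variable (k : Type) [Field k] {V : Type}

/-- The ideal spanned by the monomials whose exponent satisfies `p`. -/
def monIdeal (p : (V →₀ ℕ) → Prop) : Ideal (MvPolynomial V k) :=
  Ideal.span ((fun d => monomial d 1) '' {d | p d})

variable {k}

lemma mem_monIdeal {p : (V →₀ ℕ) → Prop} (hp : Monotone p) {f : MvPolynomial V k} :
    f ∈ monIdeal k p ↔ ∀ d ∈ f.support, p d := by
  rw [monIdeal, mem_ideal_span_monomial_image]
  exact forall₂_congr fun d _ => ⟨fun ⟨e, he, h⟩ => hp h he, fun h => ⟨d, h, le_rfl⟩⟩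

lemma monomial_mem_monIdeal {p : (V →₀ ℕ) → Prop} (hp : Monotone p) {d : V →₀ ℕ} :
    (monomial d 1 : MvPolynomial V k) ∈ monIdeal k p ↔ p d := by
  classical
  rw [mem_monIdeal hp, support_monomial, if_neg one_ne_zero]
  simp

lemma monomial_mul_mem_monIdeal {p : (V →₀ ℕ) → Prop} (hp : Monotone p) {u : V →₀ ℕ}
    {f : MvPolynomial V k} :
    monomial u 1 * f ∈ monIdeal k p ↔ f ∈ monIdeal k fun d => p (d + u) := by
  rw [mem_monIdeal hp, mem_monIdeal fun d e h => hp (add_le_add_left h u)]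
  constructor
  · intro h d hd
    apply h
    rw [mem_support_iff] at hd ⊢
    rwa [add_comm, coeff_monomial_mul, one_mul]
  · intro h d hd
    rw [mem_support_iff, coeff_monomial_mul'] at hd
    split_ifs at hd with hle
    · rw [one_mul] at hd
      simpa [tsub_add_cancel_of_le hle] using h _ (mem_support_iff.2 hd)
    · exact absurd rfl hd

lemma monIdeal_or (p q : (V →₀ ℕ) → Prop) :
    monIdeal k (fun d => p d ∨ q d) = monIdeal k p ⊔ monIdeal k q := by
  rw [monIdeal, monIdeal, monIdeal, ← Ideal.span_union, ← Set.image_union]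
  rfl

lemma monIdeal_le (u : V →₀ ℕ) :
    monIdeal k (fun d => u ≤ d) = Ideal.span {monomial u 1} := by
  refine le_antisymm (Ideal.span_le.2 ?_) (Ideal.span_le.2 ?_)
  · rintro _ ⟨d, hd, rfl⟩
    exact Ideal.mem_span_singleton.2 (monomial_dvd_monomial.2 ⟨Or.inr hd, one_dvd _⟩)
  · rintro _ rfl
    exact Ideal.subset_span ⟨u, le_refl u, rfl⟩

/-- Some power of the variable `z` annihilates the `i`-th local cohomology of the quotient by
the monomial ideal given by `p`. -/
def KilledAt (k : Type) [Field k] (z : V) (i : ℕ) (p : (V →₀ ℕ) → Prop) : Prop :=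
  ∃ s, CohKilledBy (maxIdeal k V) (X z ^ s) i
    (ModuleCat.of (MvPolynomial V k) (MvPolynomial V k ⧸ monIdeal k p))

lemma KilledAt.colon {z : V} {i : ℕ} {p : (V →₀ ℕ) → Prop} (hp : Monotone p) (u : V →₀ ℕ)
    (h : KilledAt k z i p) (h' : ∀ j, j + 1 = i → KilledAt k z j fun d => p d ∨ u ≤ d) :
    KilledAt k z i fun d => p (d + u) := by
  obtain ⟨s, hs⟩ := h
  obtain ⟨s', hs'⟩ : ∃ s', ∀ j, j + 1 = i → CohKilledBy (maxIdeal k V) (X z ^ s') j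
      (ModuleCat.of (MvPolynomial V k) (MvPolynomial V k ⧸ monIdeal k fun d => p d ∨ u ≤ d)) := by
    obtain _ | j := i
    · exact ⟨0, by simp⟩
    · obtain ⟨s', hs'⟩ := h' j rfl
      exact ⟨s', fun l hl => by obtain rfl : l = j := by omega
                                exact hs'⟩
  refine ⟨s' + s, ?_⟩
  rw [pow_add]
  exact CohKilledBy.of_colon (fun f => monomial_mul_mem_monIdeal hp)
    (by rw [monIdeal_or, monIdeal_le]) hs hs'

/-- The exponents of the monomials in the edge ideal of `(G, w)`. -/
def EdgePred (G : SimpleGraph V) (w : V → V → ℕ) (d : V →₀ ℕ) : Prop :=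
  ∃ u v, G.Adj u v ∧ w u v ≤ d u ∧ w u v ≤ d v

lemma edgePred_monotone (G : SimpleGraph V) (w : V → V → ℕ) : Monotone (EdgePred G w) :=
  fun _ _ hde ⟨u, v, h, h1, h2⟩ => ⟨u, v, h, h1.trans (hde u), h2.trans (hde v)⟩

lemma edgeIdealW_eq (G : SimpleGraph V) (w : V → V → ℕ) :
    edgeIdealW k G w = monIdeal k (EdgePred G w) := by
  have key (u v : V) (m : ℕ) : (X u * X v : MvPolynomial V k) ^ m =
      monomial (Finsupp.single u m + Finsupp.single v m) 1 := by
    rw [mul_pow, X_pow_eq_monomial, X_pow_eq_monomial, monomial_mul, one_mul]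
  refine le_antisymm (Ideal.span_le.2 ?_) (Ideal.span_le.2 ?_)
  · rintro _ ⟨u, v, h, rfl⟩
    rw [key]
    exact Ideal.subset_span ⟨_, ⟨u, v, h, by simp, by simp⟩, rfl⟩
  · rintro _ ⟨d, ⟨u, v, h, h1, h2⟩, rfl⟩
    refine Ideal.mem_of_dvd _ ?_ (Ideal.subset_span ⟨u, v, h, rfl⟩)
    rw [key]
    refine monomial_dvd_monomial.2 ⟨Or.inr fun a => ?_, one_dvd _⟩
    classical
    have := h.ne
    simp only [Finsupp.add_apply, Finsupp.single_apply]
    split_ifs <;> simp_all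

end MonomialIdeals

section Regularity

variable {k : Type} [Field k] {V : Type}

lemma mem_span_of_sum_pow_mul_mem {T : Type} [CommRing T] {C : Finset V} {s : Set (V →₀ ℕ)} {a : ℕ}
    (h₁ : ∀ v ∈ C, ∀ v' ∈ C, v ≠ v' → ∃ e ∈ s, e ≤ Finsupp.single v a + Finsupp.single v' a)
    (h₂ : ∀ u : V →₀ ℕ, (∀ v ∈ C, ∃ e ∈ s, e ≤ u + Finsupp.single v (2 * a)) → ∃ e ∈ s, e ≤ u)
    {g : MvPolynomial V T}
    (hg : (∑ v ∈ C, X v ^ a) * g ∈ Ideal.span ((fun d => monomial d (1 : T)) '' s)) :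
    g ∈ Ideal.span ((fun d => monomial d (1 : T)) '' s) := by
  classical
  set K := Ideal.span ((fun d => monomial d (1 : T)) '' s) with hK
  have hkey : ∀ v ∈ C, monomial (Finsupp.single v (2 * a)) 1 * g ∈ K := by
    intro v hv
    have h3 : X v ^ a * (∑ v' ∈ C.erase v, X v' ^ a) ∈ K := by
      rw [Finset.mul_sum]
      refine K.sum_mem fun v' hv' => ?_
      obtain ⟨hne, hv'⟩ := Finset.mem_erase.1 hv'
      obtain ⟨e, he, hle⟩ := h₁ v hv v' hv' hne.symm
      rw [X_pow_eq_monomial, X_pow_eq_monomial, monomial_mul, one_mul]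
      exact Ideal.mem_of_dvd _ (monomial_dvd_monomial.2 ⟨Or.inr hle, one_dvd _⟩)
        (Ideal.subset_span ⟨e, he, rfl⟩)
    have h4 := K.sub_mem (K.mul_mem_left (X v ^ a) hg) (K.mul_mem_right g h3)
    rw [← Finset.add_sum_erase C _ hv] at h4
    rw [← X_pow_eq_monomial, two_mul, pow_add]
    convert h4 using 1
    ring
  rw [mem_ideal_span_monomial_image]
  intro d hd
  refine h₂ d fun v hv => ?_
  refine (mem_ideal_span_monomial_image.1 (hkey v hv)) _ ?_
  rw [mem_support_iff, add_comm, coeff_monomial_mul, one_mul]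
  exact mem_support_iff.1 hd

lemma mem_of_sum_pow_mul_mem {C : Finset V} {Γ : Set (MvPolynomial V k)}
    (hΓ : ∀ γ ∈ Γ, γ ∈ Algebra.adjoin k ((X : V → MvPolynomial V k) '' {v | v ∉ C}))
    {s : Set (V →₀ ℕ)} (hs : ∀ e ∈ s, ∀ v ∉ C, e v = 0) {a : ℕ}
    (h₁ : ∀ v ∈ C, ∀ v' ∈ C, v ≠ v' → ∃ e ∈ s, e ≤ Finsupp.single v a + Finsupp.single v' a)
    (h₂ : ∀ u : V →₀ ℕ, (∀ v ∈ C, ∃ e ∈ s, e ≤ u + Finsupp.single v (2 * a)) → ∃ e ∈ s, e ≤ u)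
    {f : MvPolynomial V k}
    (hf : (∑ v ∈ C, X v ^ a) * f ∈
      Ideal.span Γ ⊔ Ideal.span ((fun d => monomial d (1 : k)) '' s)) :
    f ∈ Ideal.span Γ ⊔ Ideal.span ((fun d => monomial d (1 : k)) '' s) := by
  classical
  set J := Ideal.span Γ ⊔ Ideal.span ((fun d => monomial d (1 : k)) '' s) with hJ
  let T := MvPolynomial V k ⧸ Ideal.span Γ
  let π : MvPolynomial V k →ₐ[k] T := Ideal.Quotient.mkₐ k (Ideal.span Γ)
  let K : Ideal (MvPolynomial V T) := Ideal.span ((fun d => monomial d (1 : T)) '' s)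
  let Φ : MvPolynomial V k →ₐ[k] MvPolynomial V T :=
    aeval fun v => if v ∈ C then X v else MvPolynomial.C (π (X v))
  have hΦΓ : ∀ γ ∈ Γ, Φ γ = 0 := fun γ hγ => by
    have : Set.EqOn Φ ((Algebra.ofId T (MvPolynomial V T)).restrictScalars k |>.comp π)
        (Algebra.adjoin k ((X : V → MvPolynomial V k) '' {v | v ∉ C})) := by
      refine AlgHom.eqOn_adjoin_iff.2 ?_
      rintro _ ⟨v, hv, rfl⟩
      simp only [Φ, aeval_X, if_neg (show v ∉ C from hv)]
      rfl
    rw [this (hΓ γ hγ)]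
    have h0 : π γ = 0 := Ideal.Quotient.eq_zero_iff_mem.2 (Ideal.subset_span hγ)
    simp [h0]
  have hΦs : ∀ d ∈ s, Φ (monomial d 1) = monomial d 1 := fun d hd => by
    rw [aeval_monomial, map_one, one_mul, monomial_eq, map_one, one_mul]
    refine Finset.prod_congr rfl fun v hv => ?_
    dsimp only
    rw [if_pos]
    by_contra hvC
    exact Finsupp.mem_support_iff.1 hv (hs d hd v hvC)
  let Ψ : MvPolynomial V T →+* MvPolynomial V k ⧸ J :=
    eval₂Hom (Ideal.Quotient.factor (le_sup_left : Ideal.span Γ ≤ J))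
      fun v => Ideal.Quotient.mk J (X v)
  have hΨΦ : ∀ g, Ψ (Φ g) = Ideal.Quotient.mk J g := by
    intro g
    change (Ψ.comp Φ.toRingHom) g = Ideal.Quotient.mk J g
    congr 1
    refine ringHom_ext (fun c => ?_) fun v => ?_
    · have : Φ (MvPolynomial.C c) = MvPolynomial.C (algebraMap k T c) := by
        rw [← algebraMap_eq, AlgHom.commutes]; rfl
      change Ψ (Φ (MvPolynomial.C c)) = _
      rw [this]
      simp only [Ψ, eval₂Hom_C]
      rfl
    · change Ψ (Φ (X v)) = _
      simp only [Φ, aeval_X]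
      split_ifs
      · simp [Ψ]
      · simp only [Ψ, eval₂Hom_C]
        rfl
  have hmem : ∀ g, g ∈ J ↔ Φ g ∈ K := by
    intro g
    constructor
    · have : J ≤ K.comap Φ := by
        refine sup_le (Ideal.span_le.2 fun γ hγ => ?_) (Ideal.span_le.2 ?_)
        · simp [hΦΓ γ hγ]
        · rintro _ ⟨d, hd, rfl⟩
          change Φ (monomial d 1) ∈ K
          rw [hΦs d hd]
          exact Ideal.subset_span ⟨d, hd, rfl⟩
      exact fun hg => this hg
    · intro hg
      rw [← Ideal.Quotient.eq_zero_iff_mem, ← hΨΦ]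
      have : K ≤ RingHom.ker Ψ := by
        refine Ideal.span_le.2 ?_
        rintro _ ⟨d, hd, rfl⟩
        change Ψ (monomial d 1) = 0
        rw [← hΦs d hd, hΨΦ, Ideal.Quotient.eq_zero_iff_mem]
        exact Ideal.mem_sup_right (Ideal.subset_span ⟨d, hd, rfl⟩)
      exact this hg
  rw [hmem] at hf ⊢
  have hΦθ : Φ (∑ v ∈ C, X v ^ a) = ∑ v ∈ C, X v ^ a := by
    rw [map_sum]
    refine Finset.sum_congr rfl fun v hv => ?_
    simp [Φ, hv]
  rw [map_mul, hΦθ] at hf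
  exact mem_span_of_sum_pow_mul_mem h₁ h₂ hf

/-- Adjacency of distinct vertices is transitive: every connected component is complete. -/
def IsCliqueUnion (H : SimpleGraph V) : Prop :=
  ∀ u v w, H.Adj u v → H.Adj v w → u ≠ w → H.Adj u w

/-- The exponents of the monomials in the weighted edge ideal enlarged by the variables in `A`. -/
def EdgeVarPred (H : SimpleGraph V) (w : V → V → ℕ) (A : Set V) (d : V →₀ ℕ) : Prop :=
  EdgePred H w d ∨ ∃ v ∈ A, 1 ≤ d v

lemma edgeVarPred_monotone (H : SimpleGraph V) (w : V → V → ℕ) (A : Set V) :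
    Monotone (EdgeVarPred H w A) := fun _ _ hde h =>
  h.imp (fun h => edgePred_monotone H w hde h) fun ⟨v, hv, h⟩ => ⟨v, hv, h.trans (hde v)⟩

lemma X_mem_maxIdeal (v : V) : X v ∈ maxIdeal k V := Ideal.subset_span (Set.mem_range_self v)

lemma X_pow_mul_X_pow_mem {H : SimpleGraph V} {w : V → V → ℕ} {A : Set V} {m m' : ℕ} {u v : V}
    (h : H.Adj u v) (hm : w u v ≤ m) (hm' : w u v ≤ m') :
    (X u ^ m * X v ^ m' : MvPolynomial V k) ∈ monIdeal k (EdgeVarPred H w A) := by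
  rw [X_pow_eq_monomial, X_pow_eq_monomial, monomial_mul, one_mul,
    monomial_mem_monIdeal (edgeVarPred_monotone H w A)]
  refine Or.inl ⟨u, v, h, ?_, ?_⟩ <;>
  simp only [Finsupp.add_apply, Finsupp.single_eq_same] <;> omega

lemma exists_eq_add_support (f : MvPolynomial V k) (p : (V →₀ ℕ) → Prop) :
    ∃ g h, f = g + h ∧ (∀ d ∈ g.support, p d) ∧ ∀ d ∈ h.support, ¬p d := by
  classical
  refine ⟨∑ d ∈ f.support with p d, monomial d (coeff d f),
    ∑ d ∈ f.support with ¬p d, monomial d (coeff d f), ?_, ?_, ?_⟩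
  · rw [Finset.sum_filter_add_sum_filter_not, support_sum_monomial_coeff]
  all_goals
    intro d hd
    obtain ⟨e, he, hd⟩ := Finset.mem_biUnion.1 (support_sum hd)
    obtain rfl := Finset.mem_singleton.1 (support_monomial_subset hd)
    exact (Finset.mem_filter.1 he).2

variable [Fintype V]

open Classical in
/-- The closed neighbourhood of `r`. -/
def closedNbhd (H : SimpleGraph V) (r : V) : Finset V := {v | v = r ∨ H.Adj r v}

lemma mem_closedNbhd {H : SimpleGraph V} {r v : V} :
    v ∈ closedNbhd H r ↔ v = r ∨ H.Adj r v := by simp [closedNbhd]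

/-- The sum of the `a`-th powers of the variables in the closed neighbourhood of `r`. -/
def starSum (k : Type) [Field k] (H : SimpleGraph V) (a : ℕ) (r : V) : MvPolynomial V k :=
  ∑ v ∈ closedNbhd H r, X v ^ a

/-- The weighted edge ideal enlarged by the variables in `A` and the elements `starSum r`
for `r ∈ D`. -/
def starIdeal (k : Type) [Field k] (H : SimpleGraph V) (w : V → V → ℕ) (A : Set V) (a : ℕ)
    (D : Set V) : Ideal (MvPolynomial V k) :=
  monIdeal k (EdgeVarPred H w A) ⊔ Ideal.span (starSum k H a '' D)

lemma starIdeal_insert {H : SimpleGraph V} {w : V → V → ℕ} {A : Set V} {a : ℕ} {D : Set V}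
    {r : V} : starIdeal k H w A a (insert r D) =
      starIdeal k H w A a D ⊔ Ideal.span {starSum k H a r} := by
  rw [starIdeal, starIdeal, Set.image_insert_eq, Ideal.span_insert, sup_assoc,
    sup_comm (Ideal.span (starSum k H a '' D))]

lemma IsCliqueUnion.mem_closedNbhd_iff {H : SimpleGraph V} (hH : IsCliqueUnion H) {r u v : V}
    (h : H.Adj u v) : u ∈ closedNbhd H r ↔ v ∈ closedNbhd H r := by
  have key : ∀ u v, H.Adj u v → u ∈ closedNbhd H r → v ∈ closedNbhd H r := by
    intro u v h hu
    rw [mem_closedNbhd] at hu ⊢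
    rcases hu with rfl | hu
    · exact Or.inr h
    · by_cases hvr : v = r
      · exact Or.inl hvr
      · exact Or.inr (hH _ _ _ hu h (Ne.symm hvr))
  exact ⟨key _ _ h, key _ _ h.symm⟩

lemma mem_starIdeal_of_mul_mem {H : SimpleGraph V} (hH : IsCliqueUnion H) {w : V → V → ℕ}
    {A : Set V} (hA : ∀ u v, H.Adj u v → u ∉ A) {a : ℕ} (ha : ∀ u v, H.Adj u v → w u v ≤ a)
    {D : Set V} {r : V} (hrA : r ∉ A) (hrD : ∀ r' ∈ D, r' ≠ r ∧ ¬H.Adj r' r)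
    {f : MvPolynomial V k} (hf : starSum k H a r * f ∈ starIdeal k H w A a D) :
    f ∈ starIdeal k H w A a D := by
  classical
  let C := closedNbhd H r
  let s : Set (V →₀ ℕ) := {e | ∃ u v, H.Adj u v ∧ u ∈ C ∧ v ∈ C ∧
    e = Finsupp.single u (w u v) + Finsupp.single v (w u v)}
  let Γ : Set (MvPolynomial V k) := {γ | ∃ u v, H.Adj u v ∧ u ∉ C ∧ v ∉ C ∧
    γ = (X u * X v) ^ w u v} ∪ {γ | ∃ v ∈ A, γ = X v} ∪ starSum k H a '' D
  have hsingle : ∀ u v, H.Adj u v → ∀ m (d : V →₀ ℕ),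
      Finsupp.single u m + Finsupp.single v m ≤ d ↔ m ≤ d u ∧ m ≤ d v := by
    intro u v huv m d
    have := huv.ne
    constructor
    · intro h
      have h1 := h u
      have h2 := h v
      simp only [Finsupp.add_apply, Finsupp.single_apply, if_pos] at h1 h2
      constructor <;> omega
    · rintro ⟨h1, h2⟩ x
      simp only [Finsupp.add_apply, Finsupp.single_apply]
      split_ifs <;> simp_all
  have hmon : ∀ u v, H.Adj u v → ∀ m, (X u * X v : MvPolynomial V k) ^ m =
      monomial (Finsupp.single u m + Finsupp.single v m) 1 := fun u v _ m => by
    rw [mul_pow, X_pow_eq_monomial, X_pow_eq_monomial, monomial_mul, one_mul]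
  have hsJ : Ideal.span ((fun d => monomial d (1 : k)) '' s) ≤ starIdeal k H w A a D := by
    refine Ideal.span_le.2 ?_
    rintro _ ⟨_, ⟨u, v, h, -, -, rfl⟩, rfl⟩
    refine Ideal.mem_sup_left ((monomial_mem_monIdeal (edgeVarPred_monotone H w A)).2
      (Or.inl ⟨u, v, h, ((hsingle u v h _ _).1 le_rfl)⟩))
  have hΓJ : Ideal.span Γ ≤ starIdeal k H w A a D := by
    refine Ideal.span_le.2 ?_
    rintro _ ((⟨u, v, h, -, -, rfl⟩ | ⟨v, hv, rfl⟩) | h)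
    · rw [hmon u v h]
      exact Ideal.mem_sup_left ((monomial_mem_monIdeal (edgeVarPred_monotone H w A)).2
        (Or.inl ⟨u, v, h, ((hsingle u v h _ _).1 le_rfl)⟩))
    · exact Ideal.mem_sup_left ((monomial_mem_monIdeal (edgeVarPred_monotone H w A)).2
        (Or.inr ⟨v, hv, by simp⟩))
    · exact Ideal.mem_sup_right (Ideal.subset_span h)
  have hJ : starIdeal k H w A a D =
      Ideal.span Γ ⊔ Ideal.span ((fun d => monomial d (1 : k)) '' s) := by
    refine le_antisymm (sup_le (Ideal.span_le.2 ?_) (Ideal.span_le.2 ?_)) (sup_le hΓJ hsJ)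
    · rintro _ ⟨d, ⟨u, v, h, hd⟩ | ⟨v, hv, hd⟩, rfl⟩
      · have hdvd : (X u * X v : MvPolynomial V k) ^ w u v ∣ monomial d 1 := by
          rw [hmon u v h]
          exact monomial_dvd_monomial.2 ⟨Or.inr ((hsingle u v h _ _).2 hd), one_dvd _⟩
        refine Ideal.mem_of_dvd _ hdvd ?_
        by_cases hu : u ∈ C
        · rw [hmon u v h]
          exact Ideal.mem_sup_right (Ideal.subset_span
            ⟨_, ⟨u, v, h, hu, (hH.mem_closedNbhd_iff h).1 hu, rfl⟩, rfl⟩)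
        · exact Ideal.mem_sup_left (Ideal.subset_span (Or.inl (Or.inl
            ⟨u, v, h, hu, fun hv => hu ((hH.mem_closedNbhd_iff h).2 hv), rfl⟩)))
      · refine Ideal.mem_of_dvd _ ?_ (Ideal.mem_sup_left (Ideal.subset_span (Or.inl (Or.inr
          ⟨v, hv, rfl⟩))))
        exact monomial_dvd_monomial.2 ⟨Or.inr (by simpa using hd), one_dvd _⟩
    · exact fun γ hγ => Ideal.mem_sup_left (Ideal.subset_span (Or.inr hγ))
  have hX : ∀ v, v ∉ C → X v ∈ Algebra.adjoin k ((X : V → MvPolynomial V k) '' {v | v ∉ C}) :=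
    fun v hv => Algebra.subset_adjoin ⟨v, hv, rfl⟩
  rw [hJ] at hf ⊢
  refine mem_of_sum_pow_mul_mem (C := C) (a := a) ?_ ?_ ?_ ?_ hf
  · rintro _ ((⟨u, v, h, hu, hv, rfl⟩ | ⟨v, hv, rfl⟩) | ⟨r', hr', rfl⟩)
    · exact pow_mem (mul_mem (hX u hu) (hX v hv)) _
    · refine hX v fun hvC => ?_
      rcases mem_closedNbhd.1 hvC with rfl | h
      · exact hrA hv
      · exact hA _ _ h.symm hv
    · refine sum_mem fun v hv => pow_mem (hX v fun hvC => ?_) _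
      have h3 : r' ∈ C := by
        rcases mem_closedNbhd.1 hv with rfl | h
        · exact hvC
        · exact (hH.mem_closedNbhd_iff h).2 hvC
      rcases mem_closedNbhd.1 h3 with h | h
      · exact (hrD r' hr').1 h
      · exact (hrD r' hr').2 h.symm
  · rintro _ ⟨u, v, h, hu, hv, rfl⟩ x hx
    have h1 : u ≠ x := fun h => hx (h ▸ hu)
    have h2 : v ≠ x := fun h => hx (h ▸ hv)
    simp [h1, h2]
  · intro v hv v' hv' hne
    have hadj : H.Adj v v' := by
      rcases mem_closedNbhd.1 hv with rfl | h
      · rcases mem_closedNbhd.1 hv' with rfl | h'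
        · exact absurd rfl hne
        · exact h'
      · rcases mem_closedNbhd.1 hv' with rfl | h'
        · exact h.symm
        · exact hH _ _ _ h.symm h' hne
    refine ⟨_, ⟨v, v', hadj, hv, hv', rfl⟩, ?_⟩
    gcongr <;> exact ha _ _ hadj
  · intro u hu
    obtain ⟨v, hv, hmax⟩ := Finset.exists_max_image C u ⟨r, mem_closedNbhd.2 (Or.inl rfl)⟩
    obtain ⟨_, ⟨x, y, h, hx, hy, rfl⟩, hle⟩ := hu v hv
    refine ⟨_, ⟨x, y, h, hx, hy, rfl⟩, ?_⟩
    rw [hsingle x y h] at hle ⊢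
    have hne := h.ne
    have hmx := hmax x hx
    have hmy := hmax y hy
    simp only [Finsupp.add_apply, Finsupp.single_apply] at hle
    split_ifs at hle with h1 h2 h2
    · exact absurd (h1.symm.trans h2) hne
    · subst h1; omega
    · subst h2; omega
    · simpa using hle

end Regularity

section Vanishing

variable {k : Type} [Field k] {V : Type} [Fintype V] {H : SimpleGraph V} {w : V → V → ℕ}
  {A : Set V} {a : ℕ} {R : Finset V}

lemma starSum_mem_maxIdeal (ha : a ≠ 0) (r : V) : starSum k H a r ∈ maxIdeal k V :=
  sum_mem fun v _ => Ideal.pow_mem_of_mem _ (X_mem_maxIdeal v) _ (Nat.pos_of_ne_zero ha)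

lemma extVanishes_starIdeal (hH : IsCliqueUnion H) (hA : ∀ u v, H.Adj u v → u ∉ A)
    (hw : ∀ u v, H.Adj u v → w u v ≤ a) (ha : a ≠ 0) (hR : IsIndepSet H R)
    (hRA : ∀ r ∈ R, r ∉ A) (i : ℕ) (D : Finset V) (hD : D ⊆ R) (hi : i + D.card < R.card)
    {Y : ModuleCat.{0} (MvPolynomial V k)} {t : ℕ} (hY : Y = quotPow (maxIdeal k V) t)
    (P : ProjectiveResolution Y) :
    ExtVanishes P i (ModuleCat.of (MvPolynomial V k)
      (MvPolynomial V k ⧸ starIdeal k H w A a D)) := by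
  classical
  induction i generalizing D with
  | zero =>
    obtain ⟨r, hr, hrD⟩ := Finset.exists_mem_notMem_of_card_lt_card
      (show D.card < R.card by omega)
    subst hY
    exact extVanishes_of_regular _ (shortExact_quotProj fun f =>
      mem_starIdeal_of_mul_mem hH hA hw (hRA r hr) fun r' hr' =>
        ⟨fun h => hrD (h ▸ hr'), hR _ (hD hr') _ hr⟩)
      (pow_smul_id_quotPow (starSum_mem_maxIdeal ha r)) (by simp)
  | succ i ih =>
    obtain ⟨r, hr, hrD⟩ := Finset.exists_mem_notMem_of_card_lt_card
      (show D.card < R.card by omega)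
    have h1 := ih (insert r D) (Finset.insert_subset hr hD)
      (by rw [Finset.card_insert_of_notMem hrD]; omega)
    rw [Finset.coe_insert, starIdeal_insert] at h1
    subst hY
    exact extVanishes_of_regular _ (shortExact_quotProj fun f =>
      mem_starIdeal_of_mul_mem hH hA hw (hRA r hr) fun r' hr' =>
        ⟨fun h => hrD (h ▸ hr'), hR _ (hD hr') _ hr⟩)
      (pow_smul_id_quotPow (starSum_mem_maxIdeal ha r))
      fun j hj => by obtain rfl : j = i := by omega
                     exact h1

lemma CohKilledBy.starIdeal_of_subset (hH : IsCliqueUnion H) (hA : ∀ u v, H.Adj u v → u ∉ A)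
    (hw : ∀ u v, H.Adj u v → w u v ≤ a) (ha : a ≠ 0) (hR : IsIndepSet H R)
    (hRA : ∀ r ∈ R, r ∉ A) {b : MvPolynomial V k}
    (h : CohKilledBy (maxIdeal k V) b R.card (ModuleCat.of (MvPolynomial V k)
      (MvPolynomial V k ⧸ starIdeal k H w A a ∅))) (D : Finset V) (hD : D ⊆ R) :
    CohKilledBy (maxIdeal k V) b (R.card - D.card) (ModuleCat.of (MvPolynomial V k)
      (MvPolynomial V k ⧸ starIdeal k H w A a D)) := by
  classical
  induction D using Finset.induction_on with
  | empty =>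
    rw [Finset.coe_empty, Finset.card_empty, Nat.sub_zero]
    exact h
  | insert r D hrD ih =>
    obtain ⟨hr, hD'⟩ := Finset.insert_subset_iff.1 hD
    have hcard := Finset.card_le_card hD
    rw [Finset.card_insert_of_notMem hrD] at hcard ⊢
    rw [Finset.coe_insert, starIdeal_insert]
    refine CohKilledBy.of_regular _ (shortExact_quotProj fun f =>
      mem_starIdeal_of_mul_mem hH hA hw (hRA r hr) fun r' hr' =>
        ⟨fun h => hrD (h ▸ hr'), hR _ (hD' hr') _ hr⟩)
      (fun t P => extVanishes_starIdeal hH hA hw ha hR hRA _ D hD' (by omega) rfl P) ?_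
    rw [show R.card - (D.card + 1) + 1 = R.card - D.card by omega]
    exact ih hD'

lemma maxIdeal_le_radical (hH : IsCliqueUnion H)
    (hw : ∀ u v, H.Adj u v → w u v ≤ a) 
    (hR : ∀ v, v ∉ A → ∃ r ∈ R, v ∈ closedNbhd H r) :
    maxIdeal k V ≤ (starIdeal k H w A a R).radical := by
  classical
  refine Ideal.span_le.2 ?_
  rintro _ ⟨v, rfl⟩
  by_cases hv : v ∈ A
  · refine Ideal.le_radical (Ideal.mem_sup_left ?_)
    refine (monomial_mem_monIdeal (edgeVarPred_monotone H w A)).2 (Or.inr ⟨v, hv, by simp⟩)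
  · obtain ⟨r, hr, hvr⟩ := hR v hv
    refine ⟨a + a, ?_⟩
    have h1 : X v ^ a * starSum k H a r ∈ starIdeal k H w A a R :=
      Ideal.mul_mem_left _ _ (Ideal.mem_sup_right (Ideal.subset_span ⟨r, hr, rfl⟩))
    have h2 : X v ^ a * (∑ u ∈ (closedNbhd H r).erase v, X u ^ a) ∈ starIdeal k H w A a R := by
      rw [Finset.mul_sum]
      refine sum_mem fun u hu => Ideal.mem_sup_left ?_
      obtain ⟨hne, hu⟩ := Finset.mem_erase.1 hu
      have hadj : H.Adj v u := by
        rcases mem_closedNbhd.1 hvr with rfl | h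
        · rcases mem_closedNbhd.1 hu with rfl | h'
          · exact absurd rfl hne
          · exact h'
        · rcases mem_closedNbhd.1 hu with rfl | h'
          · exact h.symm
          · exact hH _ _ _ h.symm h' hne.symm
      exact X_pow_mul_X_pow_mem hadj (hw _ _ hadj) (hw _ _ hadj)
    rw [starSum, ← Finset.add_sum_erase _ _ hvr] at h1
    rw [pow_add]
    convert Ideal.sub_mem _ h1 h2 using 1
    ring

lemma not_killedAt (hH : IsCliqueUnion H) (hA : ∀ u v, H.Adj u v → u ∉ A)
    (hR : IsIndepSet H R) (hRA : ∀ r ∈ R, r ∉ A)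
    (hR' : ∀ v, v ∉ A → ∃ r ∈ R, v ∈ closedNbhd H r) {z : V} (hz : z ∉ A) :
    ¬KilledAt k z R.card (EdgeVarPred H (fun _ _ => 1) A) := by
  rintro ⟨s, hs⟩
  have h0 : starIdeal k H (fun _ _ => 1) A (s + 1) ∅ =
      monIdeal k (EdgeVarPred H (fun _ _ => 1) A) := by
    simp [starIdeal]
  rw [← h0] at hs
  have hw : ∀ u v, H.Adj u v → (fun _ _ => 1 : V → V → ℕ) u v ≤ s + 1 := by simp
  have h1 := CohKilledBy.starIdeal_of_subset hH hA hw s.succ_ne_zero hR hRA hs R subset_rfl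
  rw [Nat.sub_self] at h1
  obtain ⟨t, ht⟩ := Ideal.exists_pow_le_of_le_radical_of_fg
    (maxIdeal_le_radical (k := k) hH hw hR') (IsNoetherian.noetherian _)
  have h2 := h1.smul_eq_zero (t := t) (ModuleCat.ofHom (Submodule.mapQ _ _ LinearMap.id ht))
  have h3 := congrArg (fun q => q.hom (Submodule.Quotient.mk 1)) h2
  have h4 : X z ^ s ∈ starIdeal k H (fun _ _ => 1) A (s + 1) R := by
    rw [← Submodule.Quotient.mk_eq_zero]
    refine Eq.trans ?_ h3
    change _ = (X z ^ s : MvPolynomial V k) • Submodule.Quotient.mk 1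
    rw [← Submodule.Quotient.mk_smul, smul_eq_mul, mul_one]
  let p : (V →₀ ℕ) → Prop := fun d => EdgeVarPred H (fun _ _ => 1) A d ∨ ∃ v, s + 1 ≤ d v
  have hp : Monotone p := fun d e hde h =>
    h.imp (fun h => edgeVarPred_monotone _ _ _ hde h) fun ⟨v, hv⟩ => ⟨v, hv.trans (hde v)⟩
  have h5 : starIdeal k H (fun _ _ => 1) A (s + 1) R ≤ monIdeal k p := by
    refine sup_le (Ideal.span_mono (Set.image_mono fun d hd => Or.inl hd)) (Ideal.span_le.2 ?_)
    rintro _ ⟨r, -, rfl⟩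
    refine sum_mem fun v _ => ?_
    rw [X_pow_eq_monomial, monomial_mem_monIdeal hp]
    exact Or.inr ⟨v, by simp⟩
  have h6 := h5 h4
  classical
  rw [X_pow_eq_monomial, monomial_mem_monIdeal hp] at h6
  simp only [p, EdgeVarPred, EdgePred, Finsupp.single_apply] at h6
  rcases h6 with (⟨u, v, h, hu, hv⟩ | ⟨v, hv, hv'⟩) | ⟨v, hv⟩
  · have := h.ne
    split_ifs at hu hv <;> simp_all
  · split_ifs at hv' <;> simp_all
  · split_ifs at hv <;> omega

end Vanishing

section Dimension

variable {k : Type} [Field k] {V : Type} {F : Finset V} {I : Ideal (MvPolynomial V k)}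

/-- The prime ideal generated by the variables outside `F`. -/
def varIdeal (k : Type) [Field k] (F : Finset V) : Ideal (MvPolynomial V k) :=
  monIdeal k fun d => ∃ v, v ∉ F ∧ 1 ≤ d v

lemma monotone_exists_notMem (F : Finset V) :
    Monotone fun d : V →₀ ℕ => ∃ v, v ∉ F ∧ 1 ≤ d v :=
  fun _ _ h ⟨v, hv, hd⟩ => ⟨v, hv, hd.trans (h v)⟩

lemma varIdeal_eq_ker :
    varIdeal k F = RingHom.ker (killCompl (R := k) (Subtype.val_injective (p := (· ∈ F)))) := by
  classical
  ext f
  rw [varIdeal, mem_monIdeal (monotone_exists_notMem F), RingHom.mem_ker]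
  constructor
  · intro h
    ext s
    rw [coeff_killCompl, coeff_zero]
    by_contra hs
    obtain ⟨v, hv, hd⟩ := h _ (mem_support_iff.2 hs)
    rw [Finsupp.mapDomain_of_notMem_range _ _ (by simpa using hv)] at hd
    omega
  · intro h d hd
    by_contra! hF
    rw [mem_support_iff] at hd
    apply hd
    have hr : (d.support : Set V) ⊆ Set.range (Subtype.val : {x // x ∈ F} → V) := by
      intro v hv
      by_contra hv'
      have := hF v (by simpa using hv')
      rw [Finset.mem_coe, Finsupp.mem_support_iff] at hv
      omega
    have := coeff_killCompl (p := f) (Subtype.val_injective (p := (· ∈ F)))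
      (s := d.comapDomain _ Subtype.val_injective.injOn)
    rw [h, coeff_zero, Finsupp.mapDomain_comapDomain _ Subtype.val_injective _ hr] at this
    exact this.symm

instance isPrime_varIdeal : (varIdeal k F).IsPrime := by
  rw [varIdeal_eq_ker]
  exact RingHom.ker_isPrime _

lemma X_mem_varIdeal {v : V} (hv : v ∉ F) : (X v : MvPolynomial V k) ∈ varIdeal k F :=
  (monomial_mem_monIdeal (monotone_exists_notMem F)).2 ⟨v, hv, by simp⟩

lemma varIdeal_le (h : ∀ v, v ∉ F → X v ∈ I) : varIdeal k F ≤ I := by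
  classical
  refine Ideal.span_le.2 ?_
  rintro _ ⟨d, ⟨v, hv, hd⟩, rfl⟩
  refine Ideal.mem_of_dvd _ (monomial_dvd_monomial.2 ⟨Or.inr ?_, dvd_rfl⟩) (h v hv)
  exact Finsupp.single_le_iff.2 hd

lemma edgeIdealW_le_varIdeal {G : SimpleGraph V} {w : V → V → ℕ} (hF : IsIndepSet G F)
    (hw : ∀ u v, G.Adj u v → 0 < w u v) : edgeIdealW k G w ≤ varIdeal k F := by
  rw [edgeIdealW_eq]
  refine Ideal.span_mono (Set.image_mono ?_)
  rintro d ⟨u, v, huv, hu, hv⟩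
  have := hw u v huv
  by_cases h : u ∈ F
  · exact ⟨v, fun h' => hF u h v h' huv, by omega⟩
  · exact ⟨u, h, by omega⟩

variable [Fintype V]

lemma ringKrullDim_quotient_varIdeal :
    ringKrullDim (MvPolynomial V k ⧸ varIdeal k F) = F.card := by
  have e := Ideal.quotientKerAlgEquivOfSurjective
    (f := killCompl (R := k) (Subtype.val_injective (p := (· ∈ F))))
    fun p => ⟨_, killCompl_rename_app _ p⟩
  rw [varIdeal_eq_ker, ringKrullDim_eq_of_ringEquiv e.toRingEquiv,
    MvPolynomial.ringKrullDim_of_isNoetherianRing]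
  simp

lemma card_le_ringKrullDim (h : I ≤ varIdeal k F) :
    (F.card : WithBot ℕ∞) ≤ ringKrullDim (MvPolynomial V k ⧸ I) := by
  rw [← ringKrullDim_quotient_varIdeal (k := k)]
  exact ringKrullDim_le_of_surjective (Ideal.Quotient.factor h) (Ideal.Quotient.factor_surjective h)

lemma ringKrullDim_le_card {m : ℕ}
    (h : ∀ q : Ideal (MvPolynomial V k), q.IsPrime → I ≤ q →
      ∃ F : Finset V, F.card ≤ m ∧ varIdeal k F ≤ q) :
    ringKrullDim (MvPolynomial V k ⧸ I) ≤ m := by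
  rw [ringKrullDim_quotient]
  refine iSup_le fun p => ?_
  obtain ⟨F, hF, hq⟩ := h p.head.1.asIdeal p.head.1.2 p.head.2
  refine le_trans ?_ (Nat.cast_le.2 hF)
  rw [← ringKrullDim_quotient_varIdeal (k := k), ringKrullDim_quotient]
  let p' : LTSeries (PrimeSpectrum.zeroLocus (varIdeal k F : Set (MvPolynomial V k))) :=
    ⟨p.length, fun i => ⟨(p i).1, hq.trans (p.head_le i)⟩, fun i => p.step i⟩
  exact Order.LTSeries.length_le_krullDim p'

end Dimension

section Unmixed

variable {k : Type} [Field k] {V : Type} [Fintype V] {H : SimpleGraph V} {w : V → V → ℕ}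

/-- Every independent set avoiding `A` extends to an independent set avoiding `A` that
dominates the complement of `A`. -/
lemma exists_indepSet_dominating {A : Set V} {s : Finset V} (hs : IsIndepSet H s)
    (hsA : ∀ r ∈ s, r ∉ A) :
    ∃ R, s ⊆ R ∧ IsIndepSet H R ∧ (∀ r ∈ R, r ∉ A) ∧
      ∀ v, v ∉ A → ∃ r ∈ R, v ∈ closedNbhd H r := by
  classical
  obtain ⟨R, hsR, hR⟩ := exists_maximal_ge_of_wellFoundedGT
    (fun R : Finset V => IsIndepSet H R ∧ ∀ r ∈ R, r ∉ A) s ⟨hs, hsA⟩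
  refine ⟨R, hsR, hR.prop.1, hR.prop.2, fun v hv => ?_⟩
  by_contra! h
  simp only [mem_closedNbhd, not_or] at h
  have hvR : v ∉ R := fun hv' => (h v hv').1 rfl
  refine hvR (hR.le_of_ge ⟨?_, ?_⟩ (Finset.subset_insert v R) (Finset.mem_insert_self v R))
  · intro a ha b hb
    rw [Finset.mem_insert] at ha hb
    rcases ha with rfl | ha <;> rcases hb with rfl | hb
    · exact H.irrefl
    · exact fun hab => (h b hb).2 hab.symm
    · exact (h a ha).2
    · exact hR.prop.1 a ha b hb
  · intro r hr
    rcases Finset.mem_insert.1 hr with rfl | hr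
    · exact hv
    · exact hR.prop.2 r hr

/-- Over a disjoint union of complete graphs, a prime ideal containing the edge ideal contains
all the variables outside of some set of representatives of the cliques. -/
lemma IsCliqueUnion.exists_varIdeal_le (hH : IsCliqueUnion H) {R : Finset V}
    (hR : IsIndepSet H R) (hR' : ∀ v, ∃ r ∈ R, v ∈ closedNbhd H r)
    {q : Ideal (MvPolynomial V k)} (hq : q.IsPrime) (hle : edgeIdealW k H w ≤ q) :
    ∃ F : Finset V, F.card = R.card ∧ IsIndepSet H F ∧ varIdeal k F ≤ q := by
  classical
  have hedge {u v : V} (h : H.Adj u v) : (X u : MvPolynomial V k) ∈ q ∨ X v ∈ q :=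
    hq.mem_or_mem (hq.mem_of_pow_mem _ (hle (Ideal.subset_span ⟨u, v, h, rfl⟩)))
  have hφ (r : V) : ∃ u ∈ closedNbhd H r, ∀ v ∈ closedNbhd H r, v ≠ u →
      (X v : MvPolynomial V k) ∈ q := by
    by_cases h : ∃ u ∈ closedNbhd H r, (X u : MvPolynomial V k) ∉ q
    · obtain ⟨u, hu, huq⟩ := h
      refine ⟨u, hu, fun v hv hvu => (hedge ?_).resolve_left huq⟩
      rw [mem_closedNbhd] at hu hv
      rcases hu with rfl | hu
      · exact hv.resolve_left hvu
      · rcases hv with rfl | hv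
        · exact hu.symm
        · exact hH _ _ _ hu.symm hv hvu.symm
    · push Not at h
      exact ⟨r, mem_closedNbhd.2 (Or.inl rfl), fun v hv _ => h v hv⟩
  choose φ hφ₁ hφ₂ using hφ
  have hsymm {u v : V} (h : u ∈ closedNbhd H v) : v ∈ closedNbhd H u := by
    rw [mem_closedNbhd] at h ⊢
    exact h.imp Eq.symm SimpleGraph.Adj.symm
  have htrans {u v x : V} (h : u ∈ closedNbhd H v) (h' : v ∈ closedNbhd H x) :
      u ∈ closedNbhd H x := by
    rcases mem_closedNbhd.1 h with rfl | h
    · exact h'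
    · exact (hH.mem_closedNbhd_iff h).1 h'
  have hRR {r r' : V} (hr : r ∈ R) (hr' : r' ∈ R) (h : r ∈ closedNbhd H r') : r = r' :=
    (mem_closedNbhd.1 h).resolve_right (hR _ hr' _ hr)
  refine ⟨R.image φ, Finset.card_image_of_injOn ?_, ?_, varIdeal_le fun v hv => ?_⟩
  · intro r hr r' hr' h
    refine hRR hr hr' (htrans (hsymm (hφ₁ r)) ?_)
    rw [h]
    exact hφ₁ r'
  · simp only [IsIndepSet, Finset.mem_image]
    rintro _ ⟨r, hr, rfl⟩ _ ⟨r', hr', rfl⟩ h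
    have := hRR hr hr' (htrans (hsymm (hφ₁ r)) ((hH.mem_closedNbhd_iff h).2 (hφ₁ r')))
    subst this
    exact H.irrefl h
  · obtain ⟨r, hr, hv'⟩ := hR' v
    exact hφ₂ r v hv' fun h => hv (h ▸ Finset.mem_image_of_mem _ hr)

lemma IsCliqueUnion.ringKrullDim_eq (hH : IsCliqueUnion H) {R : Finset V}
    (hR : IsIndepSet H R) (hR' : ∀ v, ∃ r ∈ R, v ∈ closedNbhd H r)
    (hw : ∀ u v, H.Adj u v → 0 < w u v) :
    ringKrullDim (MvPolynomial V k ⧸ edgeIdealW k H w) = R.card := by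
  refine le_antisymm (ringKrullDim_le_card fun q hq hle => ?_)
    (card_le_ringKrullDim (edgeIdealW_le_varIdeal hR hw))
  obtain ⟨F, hF, -, hle'⟩ := hH.exists_varIdeal_le hR hR' hq hle
  exact ⟨F, hF.le, hle'⟩

lemma IsCliqueUnion.edgePred_of_forall (hH : IsCliqueUnion H) (hw : ∀ u v, w u v = w v u)
    {F : Finset V} (hF : IsIndepSet H F)
    {c u : V →₀ ℕ} (hc : ∀ v, v ∉ F → c v = 0) (hcu : EdgePred H w (c + u))
    (hu : ∀ v, v ∉ F → EdgePred H w (u + Finsupp.single v 1)) : EdgePred H w u := by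
  classical
  by_contra hnot
  obtain ⟨f, v, hf, hfv, hfu, hvu⟩ : ∃ f v, f ∈ F ∧ H.Adj f v ∧ u f < w f v ∧ w f v ≤ u v := by
    obtain ⟨a, b, hab, ha, hb⟩ := hcu
    rw [Finsupp.add_apply] at ha hb
    by_cases haF : a ∈ F
    · have hbF : b ∉ F := fun hbF => hF a haF b hbF hab
      rw [hc b hbF, zero_add] at hb
      exact ⟨a, b, haF, hab, by_contra fun h => hnot ⟨a, b, hab, not_lt.1 h, hb⟩, hb⟩
    · rw [hc a haF, zero_add] at ha
      by_cases hbF : b ∈ F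
      · rw [hw] at ha hb
        exact ⟨b, a, hbF, hab.symm,
          by_contra fun h => hnot ⟨b, a, hab.symm, not_lt.1 h, ha⟩, ha⟩
      · rw [hc b hbF, zero_add] at hb
        exact absurd ⟨a, b, hab, ha, hb⟩ hnot
  obtain ⟨v', hv', hmax⟩ := Finset.exists_max_image ((closedNbhd H f).erase f) u
    ⟨v, Finset.mem_erase.2 ⟨hfv.ne', mem_closedNbhd.2 (Or.inr hfv)⟩⟩
  rw [Finset.mem_erase, mem_closedNbhd] at hv'
  have hfv' : H.Adj f v' := hv'.2.resolve_left hv'.1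
  have hvv' : u v ≤ u v' :=
    hmax v (Finset.mem_erase.2 ⟨hfv.ne', mem_closedNbhd.2 (Or.inr hfv)⟩)
  have key : ∀ l, H.Adj v' l → w v' l ≤ u v' + 1 → w v' l ≤ u l → False := by
    intro l hl h₁ h₂
    have h₃ : u v' < w v' l := by_contra fun h => hnot ⟨v', l, hl, not_lt.1 h, h₂⟩
    by_cases hlf : l = f
    · subst hlf
      omega
    · have := hmax l (Finset.mem_erase.2 ⟨hlf,
        mem_closedNbhd.2 (Or.inr (hH _ _ _ hfv' hl (Ne.symm hlf)))⟩)
      omega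
  obtain ⟨a, b, hab, ha, hb⟩ := hu v' fun h => hF f hf v' h hfv'
  rw [Finsupp.add_apply, Finsupp.single_apply] at ha hb
  split_ifs at ha hb with h₁ h₂ h₂
  · exact H.irrefl (h₁ ▸ h₂ ▸ hab)
  · subst h₁
    exact key b hab ha hb
  · subst h₂
    rw [hw] at ha hb
    exact key a hab.symm hb ha
  · exact hnot ⟨a, b, hab, ha, hb⟩

lemma IsCliqueUnion.eq_varIdeal_of_isAssociatedPrime [LinearOrder V] (hH : IsCliqueUnion H)
    (hw : ∀ u v, w u v = w v u) {F : Finset V} (hF : IsIndepSet H F)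
    {P : Ideal (MvPolynomial V k)}
    (hP : IsAssociatedPrime P (MvPolynomial V k ⧸ edgeIdealW k H w)) (hFP : varIdeal k F ≤ P) :
    P = varIdeal k F := by
  classical
  obtain ⟨hPprime, x, hx⟩ := isAssociatedPrime_iff.1 hP
  obtain ⟨f, rfl⟩ := Submodule.Quotient.mk_surjective _ x
  have hmem (g : MvPolynomial V k) : g ∈ P ↔ g * f ∈ edgeIdealW k H w := by
    rw [hx, Submodule.mem_colon_singleton, Submodule.mem_bot]
    exact Submodule.Quotient.mk_eq_zero _
  have hmon := edgePred_monotone H w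
  rw [edgeIdealW_eq] at hmem
  refine le_antisymm (fun g hg => by_contra fun hgF => ?_) hFP
  obtain ⟨g₁, g₀, rfl, hg₁, hg₀⟩ := exists_eq_add_support g fun d => ∃ v, v ∉ F ∧ 1 ≤ d v
  obtain ⟨f₁, f₀, rfl, hf₁, hf₀⟩ := exists_eq_add_support f (EdgePred H w)
  have hg₁F : g₁ ∈ varIdeal k F := (mem_monIdeal (monotone_exists_notMem F)).2 hg₁
  have hf₁I : f₁ ∈ monIdeal k (EdgePred H w) := (mem_monIdeal hmon).2 hf₁
  have hmem₀ (g : MvPolynomial V k) (hg : g ∈ P) : g * f₀ ∈ monIdeal k (EdgePred H w) := by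
    have := (hmem g).1 hg
    rw [mul_add] at this
    exact (Ideal.add_mem_iff_right _ (Ideal.mul_mem_left _ g hf₁I)).1 this
  have hg₀P : g₀ ∈ P := (Ideal.add_mem_iff_right _ (hFP hg₁F)).1 hg
  have hg₀0 : g₀ ≠ 0 := by
    rintro rfl
    rw [add_zero] at hgF
    exact hgF hg₁F
  have hf₀0 : f₀ ≠ 0 := by
    rintro rfl
    rw [add_zero] at hmem
    exact hPprime.one_notMem ((hmem 1).2 (by rwa [one_mul]))
  let m : MonomialOrder V := MonomialOrder.lex
  have hf₀s : m.degree f₀ ∈ f₀.support := m.degree_mem_support hf₀0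
  refine hf₀ _ hf₀s (hH.edgePred_of_forall hw hF (c := m.degree g₀) ?_ ?_ ?_)
  · intro v hv
    by_contra h
    exact hg₀ _ (m.degree_mem_support hg₀0) ⟨v, hv, Nat.one_le_iff_ne_zero.2 h⟩
  · refine (mem_monIdeal hmon).1 (hmem₀ g₀ hg₀P) _ ?_
    rw [← m.degree_mul hg₀0 hf₀0]
    exact m.degree_mem_support (mul_ne_zero hg₀0 hf₀0)
  · intro v hv
    refine (mem_monIdeal hmon).1 (hmem₀ _ (hFP (X_mem_varIdeal hv))) _ ?_
    rw [mem_support_iff, add_comm, X, coeff_monomial_mul, one_mul]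
    exact mem_support_iff.1 hf₀s

lemma IsCliqueUnion.isUnmixedIdeal [LinearOrder V] (hH : IsCliqueUnion H)
    (hw : ∀ u v, w u v = w v u) (hw' : ∀ u v, H.Adj u v → 0 < w u v) :
    IsUnmixedIdeal (edgeIdealW k H w) := by
  intro P hP
  obtain ⟨R, -, hR, -, hR'⟩ := exists_indepSet_dominating (H := H) (A := ∅) (s := ∅)
    (by simp [IsIndepSet]) (by simp)
  replace hR' : ∀ v, ∃ r ∈ R, v ∈ closedNbhd H r := fun v => hR' v (Set.notMem_empty v)
  replace hP := AssociatedPrimes.mem_iff.1 hP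
  have hle : edgeIdealW k H w ≤ P := by
    obtain ⟨-, x, hx⟩ := isAssociatedPrime_iff.1 hP
    obtain ⟨f, rfl⟩ := Submodule.Quotient.mk_surjective _ x
    intro g hg
    rw [hx, Submodule.mem_colon_singleton, Submodule.mem_bot]
    exact (Submodule.Quotient.mk_eq_zero _).2 (Ideal.mul_mem_right f _ hg)
  obtain ⟨F, hFR, hF, hFP⟩ := hH.exists_varIdeal_le hR hR' hP.isPrime hle
  rw [hH.eq_varIdeal_of_isAssociatedPrime hw hF hP hFP, ringKrullDim_quotient_varIdeal, hFR,
    hH.ringKrullDim_eq hR hR' hw']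

end Unmixed

section CohenMacaulay

variable {k : Type} [Field k] {V : Type} [Fintype V] {H : SimpleGraph V} {w : V → V → ℕ}

lemma IsCliqueUnion.isCMIdeal (hH : IsCliqueUnion H) (hw : ∀ u v, H.Adj u v → 0 < w u v) :
    IsCMIdeal (maxIdeal k V) (edgeIdealW k H w) := by
  intro i hi
  obtain ⟨R, -, hR, -, hR'⟩ := exists_indepSet_dominating (H := H) (A := ∅) (s := ∅)
    (by simp [IsIndepSet]) (by simp)
  rw [hH.ringKrullDim_eq hR (fun v => hR' v (Set.notMem_empty v)) hw, Nat.cast_lt] at hi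
  have heq : edgeIdealW k H w =
      starIdeal k H w ∅ (∑ u, ∑ v, w u v + 1) ((∅ : Finset V) : Set V) := by
    rw [edgeIdealW_eq, starIdeal, Finset.coe_empty, Set.image_empty, Ideal.span_empty, sup_bot_eq]
    congr 1
    ext d
    simp [EdgeVarPred]
  refine isZero_localCohomology fun t P => ?_
  rw [heq]
  refine extVanishes_starIdeal hH (by simp) (fun u v _ => ?_) (Nat.succ_ne_zero _) hR (by simp) i
    ∅ (Finset.empty_subset R) (by simpa using hi) rfl P
  refine Nat.le_succ_of_le ?_
  exact (Finset.single_le_sum (f := fun v => w u v) (fun _ _ => Nat.zero_le _)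
    (Finset.mem_univ v)).trans (Finset.single_le_sum (f := fun u => ∑ v, w u v)
      (fun _ _ => Nat.zero_le _) (Finset.mem_univ u))

lemma IsCMIdeal.isGCMIdeal {R : Type} [CommRing R] {J I : Ideal R} (h : IsCMIdeal J I) :
    IsGCMIdeal J I := fun i hi =>
  have := ModuleCat.subsingleton_of_isZero (h i hi)
  .of_subsingleton

lemma IsCMIdeal.isBuchsbaumIdeal {R : Type} [CommRing R] {J I : Ideal R} (h : IsCMIdeal J I) :
    IsBuchsbaumIdeal J I := fun i hi _ =>
  have := ModuleCat.subsingleton_of_isZero (h i hi)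
  ⟨0, Subsingleton.elim (α := localCoh J i (R ⧸ I)) _ _⟩

end CohenMacaulay

section InducedPath

open scoped Classical in
/-- The weight function with value `α` on `xy`, value `β` on `yz`, equal to `w` on the edges
inside `B`, and with value `1` elsewhere. -/
def pathWeight {V : Type} (x y z : V) (α β : ℕ) (B : Finset V) (w : V → V → ℕ) (u v : V) : ℕ :=
  if (u = x ∧ v = y) ∨ (u = y ∧ v = x) then α
  else if (u = y ∧ v = z) ∨ (u = z ∧ v = y) then β
  else if u ∈ B ∧ v ∈ B then w u v else 1

variable {k : Type} [Field k] {V : Type} {G : SimpleGraph V} {w : V → V → ℕ}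
  {x y z : V} {α β : ℕ} {B : Finset V}

lemma pathWeight_comm (hw : ∀ u v, w u v = w v u) (u v : V) :
    pathWeight x y z α β B w u v = pathWeight x y z α β B w v u := by
  unfold pathWeight
  rw [hw u v]
  grind

lemma pathWeight_pos (hw : ∀ u v, 0 < w u v) (hα : 0 < α) (hβ : 0 < β) (u v : V) :
    0 < pathWeight x y z α β B w u v := by
  unfold pathWeight
  grind

/-- The exponents of the monomials in the ideal generated by the weighted edges inside `B`, the
edges of `H` and the variables in `A`. -/
def StatePred (G : SimpleGraph V) (w : V → V → ℕ) (B : Finset V) (H : SimpleGraph V) (A : Set V)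
    (d : V →₀ ℕ) : Prop :=
  (∃ u ∈ B, ∃ v ∈ B, G.Adj u v ∧ w u v ≤ d u ∧ w u v ≤ d v) ∨ EdgeVarPred H (fun _ _ => 1) A d

lemma statePred_monotone (B : Finset V) (H : SimpleGraph V) (A : Set V) :
    Monotone (StatePred G w B H A) := fun _ _ hde h =>
  h.imp (fun ⟨u, hu, v, hv, h, h1, h2⟩ => ⟨u, hu, v, hv, h, h1.trans (hde u), h2.trans (hde v)⟩)
    fun h => edgeVarPred_monotone _ _ _ hde h

variable {H : SimpleGraph V} {A : Set V}

open Classical in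
/-- The weight function with value `α` on `ab`, equal to `w` on the edges inside `B`, and with
value `1` elsewhere. -/
def edgeWeight {V : Type} (a b : V) (α : ℕ) (B : Finset V) (w : V → V → ℕ) (u v : V) : ℕ :=
  if (u = a ∧ v = b) ∨ (u = b ∧ v = a) then α else if u ∈ B ∧ v ∈ B then w u v else 1

lemma edgeWeight_comm {a b : V} (hw : ∀ u v, w u v = w v u) (u v : V) :
    edgeWeight a b α B w u v = edgeWeight a b α B w v u := by
  unfold edgeWeight
  rw [hw u v]
  grind

lemma edgeWeight_pos {a b : V} (hw : ∀ u v, 0 < w u v) (hα : 0 < α) (u v : V) :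
    0 < edgeWeight a b α B w u v := by
  unfold edgeWeight
  grind

lemma statePred_edgeWeight_or {a b : V} (ha : a ∈ B) (hb : b ∈ B) (hab : G.Adj a b)
    (B' : Finset V) (d : V →₀ ℕ) :
    (StatePred G (edgeWeight a b 2 B' w) B H A d ∨
        Finsupp.single a 1 + Finsupp.single b 1 ≤ d) ↔
      StatePred G (edgeWeight a b 1 B' w) B H A d := by
  classical
  have hab' := hab.ne
  have hle : Finsupp.single a 1 + Finsupp.single b 1 ≤ d ↔ 1 ≤ d a ∧ 1 ≤ d b := by
    constructor
    · intro h
      have h1 := h a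
      have h2 := h b
      simp [hab', hab'.symm] at h1 h2
      exact ⟨h1, h2⟩
    · rintro ⟨h1, h2⟩ v
      simp only [Finsupp.add_apply, Finsupp.single_apply]
      split_ifs <;> simp_all
  rw [hle, StatePred, StatePred]
  constructor
  · rintro ((⟨u, hu, v, hv, h, h1, h2⟩ | h) | ⟨h1, h2⟩)
    · refine Or.inl ⟨u, hu, v, hv, h, ?_⟩
      unfold edgeWeight at *
      grind
    · exact Or.inr h
    · refine Or.inl ⟨a, ha, b, hb, hab, ?_⟩
      simp [edgeWeight, h1, h2]
  · rintro (⟨u, hu, v, hv, h, h1, h2⟩ | h)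
    · by_cases huv : (u = a ∧ v = b) ∨ (u = b ∧ v = a)
      · right
        simp only [edgeWeight, huv, if_true] at h1 h2
        grind
      · refine Or.inl (Or.inl ⟨u, hu, v, hv, h, ?_⟩)
        simp only [edgeWeight, huv, if_false] at h1 h2 ⊢
        exact ⟨h1, h2⟩
    · exact Or.inl (Or.inr h)

variable [Fintype V]

open Classical in
/-- The vertices outside the closed neighbourhoods of `x`, `y` and `z`. -/
def farVertices (G : SimpleGraph V) (x y z : V) : Finset V :=
  {v | v ∉ closedNbhd G x ∧ v ∉ closedNbhd G y ∧ v ∉ closedNbhd G z}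

lemma mem_farVertices {v : V} : v ∈ farVertices G x y z ↔
    (v ≠ x ∧ ¬G.Adj x v) ∧ (v ≠ y ∧ ¬G.Adj y v) ∧ (v ≠ z ∧ ¬G.Adj z v) := by
  simp [farVertices, mem_closedNbhd]

/-- The combinatorial data describing a stage of the reduction of a graph containing the induced
path `x`, `y`, `z` to a disjoint union of complete graphs. -/
structure IsStage (G : SimpleGraph V) (x y z : V) (B : Finset V) (H : SimpleGraph V)
    (A : Set V) : Prop where
  isCliqueUnion : IsCliqueUnion H
  notMem_of_mem : ∀ v ∈ B, v ∉ A
  notMem_of_adj : ∀ u v, H.Adj u v → u ∉ B ∧ u ∉ A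
  adj_or : ∀ u v, u ∉ A → v ∉ A → G.Adj u v → H.Adj u v ∨ (u ∈ B ∧ v ∈ B)
  mem : x ∈ A
  eq_of_adj : ∀ v, v ∉ A → G.Adj x v → v = y
  adj : H.Adj y z

lemma isStage_farVertices (hxy : G.Adj x y) (hyz : G.Adj y z) (hxz : ¬G.Adj x z) (hne : x ≠ z) :
    IsStage G x y z (farVertices G x y z) (SimpleGraph.fromEdgeSet {s(y, z)})
      {v | v ≠ y ∧ v ≠ z ∧ v ∉ farVertices G x y z} where
  isCliqueUnion u v w h h' hne := by
    simp at h h'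
    grind
  notMem_of_mem v hv hv' := hv'.2.2 hv
  notMem_of_adj u v h := by
    simp at h
    simp [mem_farVertices]
    grind
  adj_or u v hu hv h := by
    have h' := h.symm
    have hu' : u = y ∨ u = z ∨ u ∈ farVertices G x y z := by grind
    have hv' : v = y ∨ v = z ∨ v ∈ farVertices G x y z := by grind
    have huv := h.ne
    rcases hu' with rfl | rfl | hu' <;> rcases hv' with rfl | rfl | hv' <;>
      first
      | exact absurd rfl huv
      | exact Or.inr ⟨hu', hv'⟩
      | exact absurd h' (mem_farVertices.1 hu').2.1.2
      | exact absurd h' (mem_farVertices.1 hu').2.2.2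
      | exact absurd h (mem_farVertices.1 hv').2.1.2
      | exact absurd h (mem_farVertices.1 hv').2.2.2
      | exact Or.inl (by simp [huv])
  mem := by
    simp [mem_farVertices, hxy.ne, hne]
  eq_of_adj v hv h := by
    simp [mem_farVertices] at hv
    grind
  adj := by simp [hyz.ne]

open Classical in
/-- The part of `B` outside the closed neighbourhoods of `a` and `b`. -/
def collapse (G : SimpleGraph V) (B : Finset V) (a b : V) : Finset V :=
  {v ∈ B | v ∉ closedNbhd G a ∧ v ∉ closedNbhd G b}

lemma mem_collapse {a b v : V} : v ∈ collapse G B a b ↔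
    v ∈ B ∧ (v ≠ a ∧ ¬G.Adj a v) ∧ (v ≠ b ∧ ¬G.Adj b v) := by
  simp [collapse, mem_closedNbhd]

lemma IsStage.collapse (h : IsStage G x y z B H A) {a b : V} (ha : a ∈ B) (hb : b ∈ B) :
    IsStage G x y z (collapse G B a b) (H ⊔ SimpleGraph.fromEdgeSet {s(a, b)})
      (A ∪ {v | v ∈ B ∧ v ≠ a ∧ v ≠ b ∧ v ∉ SkewTab.collapse G B a b}) where
  isCliqueUnion u v w h₁ h₂ hne := by
    have := h.isCliqueUnion u v w
    have := h.notMem_of_adj u v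
    have := h.notMem_of_adj v w
    have := fun h' : H.Adj u v => h.notMem_of_adj v u h'.symm
    simp at h₁ h₂ ⊢
    grind
  notMem_of_mem v hv := by
    have := h.notMem_of_mem v
    simp [mem_collapse] at hv ⊢
    grind
  notMem_of_adj u v h' := by
    have := h.notMem_of_adj u v
    have := h.notMem_of_mem
    simp [mem_collapse] at h' ⊢
    grind
  adj_or u v hu hv huv := by
    have := h.adj_or u v
    have := huv.ne
    have := huv.symm
    simp [mem_collapse] at hu hv ⊢
    grind +splitImp
  mem := Or.inl h.mem
  eq_of_adj v hv := h.eq_of_adj v fun hv' => hv (Or.inl hv')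
  adj := Or.inl h.adj

lemma IsStage.statePred_add (h : IsStage G x y z B H A) {a b : V} (ha : a ∈ B) (hb : b ∈ B)
    (hab : G.Adj a b) (d : V →₀ ℕ) :
    StatePred G (edgeWeight a b 2 (SkewTab.collapse G B a b) w) B H A
        (d + (Finsupp.single a 1 + Finsupp.single b 1)) ↔
      StatePred G w (SkewTab.collapse G B a b) (H ⊔ SimpleGraph.fromEdgeSet {s(a, b)})
        (A ∪ {v | v ∈ B ∧ v ≠ a ∧ v ≠ b ∧ v ∉ SkewTab.collapse G B a b}) d := by
  classical
  have hab' := hab.ne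
  generalize he : d + (Finsupp.single a 1 + Finsupp.single b 1) = e
  have hda : e a = d a + 1 := by simp [← he, hab'.symm]
  have hdb : e b = d b + 1 := by simp [← he, hab']
  have hd : ∀ v, v ≠ a → v ≠ b → e v = d v := by
    intro v h1 h2
    simp [← he, h1, h2]
  have hd' : ∀ v, v ∉ B → e v = d v := fun v hv =>
    hd v (fun h => hv (h ▸ ha)) fun h => hv (h ▸ hb)
  constructor
  · rintro (⟨u, hu, v, hv, huv, h1, h2⟩ | ⟨u, v, huv, h1, h2⟩ | ⟨v, hv, h1⟩)
    · have := huv.ne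
      have := huv.symm
      by_cases hc : (u = a ∧ v = b) ∨ (u = b ∧ v = a)
      · refine Or.inr (Or.inl ⟨a, b, Or.inr (by simpa using hab'), ?_⟩)
        simp only [edgeWeight, hc, if_true] at h1 h2
        grind
      · by_cases hB : u ∈ SkewTab.collapse G B a b ∧ v ∈ SkewTab.collapse G B a b
        · refine Or.inl ⟨u, hB.1, v, hB.2, huv, ?_⟩
          simp only [edgeWeight, hc, hB.1, hB.2, and_self, if_true, if_false] at h1 h2
          rw [mem_collapse, mem_collapse] at hB
          grind
        · simp only [edgeWeight, hc, hB, if_false] at h1 h2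
          have : (u ∉ SkewTab.collapse G B a b ∧ u ≠ a ∧ u ≠ b) ∨
              (v ∉ SkewTab.collapse G B a b ∧ v ≠ a ∧ v ≠ b) := by
            rw [mem_collapse, mem_collapse] at *
            grind
          rcases this with ⟨h3, h4, h5⟩ | ⟨h3, h4, h5⟩
          · exact Or.inr (Or.inr ⟨u, Or.inr ⟨hu, h4, h5, h3⟩, by grind⟩)
          · exact Or.inr (Or.inr ⟨v, Or.inr ⟨hv, h4, h5, h3⟩, by grind⟩)
    · have h3 := (h.notMem_of_adj u v huv).1
      have h4 := (h.notMem_of_adj v u huv.symm).1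
      rw [hd' u h3] at h1
      rw [hd' v h4] at h2
      exact Or.inr (Or.inl ⟨u, v, Or.inl huv, h1, h2⟩)
    · rw [hd' v fun h' => h.notMem_of_mem v h' hv] at h1
      exact Or.inr (Or.inr ⟨v, Or.inl hv, h1⟩)
  · have hde : ∀ v, d v ≤ e v := fun v => by simp [← he]
    rintro (⟨u, hu, v, hv, huv, h1, h2⟩ | ⟨u, v, huv, h1, h2⟩ | ⟨v, hv | hv, h1⟩)
    · have hu' := mem_collapse.1 hu
      have hv' := mem_collapse.1 hv
      refine Or.inl ⟨u, hu'.1, v, hv'.1, huv, ?_⟩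
      unfold edgeWeight
      grind
    · rcases huv with huv | huv
      · exact Or.inr (Or.inl ⟨u, v, huv, h1.trans (hde u), h2.trans (hde v)⟩)
      · refine Or.inl ⟨a, ha, b, hb, hab, ?_⟩
        simp at huv
        simp only [edgeWeight, and_self, true_or, if_true]
        grind
    · exact Or.inr (Or.inr ⟨v, hv, h1.trans (hde v)⟩)
    · obtain ⟨hvB, hva, hvb, hv⟩ := hv
      rw [mem_collapse] at hv
      by_cases hav : G.Adj a v
      · refine Or.inl ⟨a, ha, v, hvB, hav, ?_⟩
        simp only [edgeWeight, mem_collapse]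
        grind
      · refine Or.inl ⟨b, hb, v, hvB, by grind, ?_⟩
        simp only [edgeWeight, mem_collapse]
        grind

/-- A graph containing the induced path `x`, `y`, `z` can be reduced to a disjoint union of
complete graphs. -/
lemma IsStage.exists_killedAt {N : ℕ} {B : Finset V} {H : SimpleGraph V} {A : Set V}
    (h : IsStage G x y z B H A)
    (hk : ∀ w : V → V → ℕ, (∀ u v, w u v = w v u) → (∀ u v, 0 < w u v) → ∀ i, i < N →
      KilledAt k z i (StatePred G w B H A)) :
    ∃ B H A, IsStage G x y z B H A ∧ (∀ u ∈ B, ∀ v ∈ B, ¬G.Adj u v) ∧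
      ∀ i, i < N → KilledAt k z i (EdgeVarPred H (fun _ _ => 1) A) := by
  classical
  induction hB : B.card using Nat.strong_induction_on generalizing B H A with
  | _ m ih =>
  by_cases hB' : ∃ a ∈ B, ∃ b ∈ B, G.Adj a b
  · obtain ⟨a, ha, b, hb, hab⟩ := hB'
    refine ih _ ?_ (h.collapse ha hb) (fun w hw hw' i hi => ?_) rfl
    · rw [← hB]
      refine Finset.card_lt_card (Finset.ssubset_iff_of_subset (fun v hv =>
        (mem_collapse.1 hv).1) |>.2 ⟨a, ha, fun h => (mem_collapse.1 h).2.1.1 rfl⟩)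
    · rw [← funext fun d => propext (h.statePred_add (w := w) ha hb hab d)]
      refine KilledAt.colon (statePred_monotone _ _ _) _
        (hk _ (edgeWeight_comm hw) (edgeWeight_pos hw' two_pos) i hi) fun j hj => ?_
      rw [funext fun d => propext (statePred_edgeWeight_or ha hb hab _ d)]
      exact hk _ (edgeWeight_comm hw) (edgeWeight_pos hw' one_pos) j (by omega)
  · push Not at hB'
    refine ⟨B, H, A, h, hB', fun i hi => ?_⟩
    have := hk (fun _ _ => 1) (fun _ _ => rfl) (fun _ _ => one_pos) i hi
    rwa [show StatePred G (fun _ _ => 1) B H A = EdgeVarPred H (fun _ _ => 1) A from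
      funext fun d => propext ⟨fun h => h.resolve_left fun ⟨u, hu, v, hv, huv, _⟩ =>
        hB' u hu v hv huv, Or.inr⟩] at this

end InducedPath

section PathWeight

variable {k : Type} [Field k] {V : Type} [Fintype V] {G : SimpleGraph V} {w : V → V → ℕ}
  {x y z : V}

lemma edgePred_pathWeight_iff (hxy : G.Adj x y) (hyz : G.Adj y z) (hne : x ≠ z) {α β : ℕ}
    (d : V →₀ ℕ) :
    EdgePred G (pathWeight x y z α β (farVertices G x y z) w) d ↔
      (α ≤ d x ∧ α ≤ d y) ∨ (β ≤ d y ∧ β ≤ d z) ∨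
      (∃ u ∈ farVertices G x y z, ∃ v ∈ farVertices G x y z,
        G.Adj u v ∧ w u v ≤ d u ∧ w u v ≤ d v) ∨
      ∃ u v, G.Adj u v ∧ s(u, v) ≠ s(x, y) ∧ s(u, v) ≠ s(y, z) ∧
        ¬(u ∈ farVertices G x y z ∧ v ∈ farVertices G x y z) ∧ 1 ≤ d u ∧ 1 ≤ d v := by
  have hxF : x ∉ farVertices G x y z := by simp [mem_farVertices]
  have hyF : y ∉ farVertices G x y z := by simp [mem_farVertices]
  have hzF : z ∉ farVertices G x y z := by simp [mem_farVertices]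
  generalize farVertices G x y z = B at *
  have h1 := hxy.ne
  have h2 := hyz.ne
  simp only [ne_eq, Sym2.eq_iff]
  constructor
  · rintro ⟨u, v, huv, h⟩
    by_cases huv1 : (u = x ∧ v = y) ∨ (u = y ∧ v = x)
    · simp only [pathWeight, huv1, if_true] at h
      grind
    by_cases huv2 : (u = y ∧ v = z) ∨ (u = z ∧ v = y)
    · simp only [pathWeight, huv1, huv2, if_true, if_false] at h
      grind
    by_cases huv3 : u ∈ B ∧ v ∈ B
    · simp only [pathWeight, huv1, huv2, huv3, and_self, if_true, if_false] at h
      exact Or.inr (Or.inr (Or.inl ⟨u, huv3.1, v, huv3.2, huv, h⟩))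
    · simp only [pathWeight, huv1, huv2, huv3, if_false] at h
      exact Or.inr (Or.inr (Or.inr ⟨u, v, huv, huv1, huv2, huv3, h⟩))
  · rintro (h | h | ⟨u, hu, v, hv, huv, h⟩ | ⟨u, v, huv, h3, h4, h5, h⟩)
    · exact ⟨x, y, hxy, by simpa [pathWeight] using h⟩
    · refine ⟨y, z, hyz, ?_⟩
      have : ¬((y = x ∧ z = y) ∨ (y = y ∧ z = x)) := by grind
      rw [pathWeight, if_neg this, if_pos (Or.inl ⟨rfl, rfl⟩)]
      exact h
    · refine ⟨u, v, huv, ?_⟩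
      have h3 : ¬((u = x ∧ v = y) ∨ (u = y ∧ v = x)) := by grind
      have h4 : ¬((u = y ∧ v = z) ∨ (u = z ∧ v = y)) := by grind
      simpa only [pathWeight, h3, h4, hu, hv, and_self, if_true, if_false] using h
    · refine ⟨u, v, huv, ?_⟩
      simpa only [pathWeight, h3, h4, h5, if_false] using h

lemma edgePred_pathWeight_or (hxy : G.Adj x y) (hyz : G.Adj y z) (hne : x ≠ z) {α β : ℕ}
    (d : V →₀ ℕ) :
    (EdgePred G (pathWeight x y z α (β + 1) (farVertices G x y z) w) d ∨
        Finsupp.single y β + Finsupp.single z β ≤ d) ↔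
      EdgePred G (pathWeight x y z α β (farVertices G x y z) w) d := by
  classical
  have h2 := hyz.ne
  have hle : Finsupp.single y β + Finsupp.single z β ≤ d ↔ β ≤ d y ∧ β ≤ d z := by
    constructor
    · intro h
      have h3 := h y
      have h4 := h z
      simp [h2, h2.symm] at h3 h4
      exact ⟨h3, h4⟩
    · rintro ⟨h3, h4⟩ v
      simp only [Finsupp.add_apply, Finsupp.single_apply]
      split_ifs <;> simp_all
  rw [hle, edgePred_pathWeight_iff hxy hyz hne, edgePred_pathWeight_iff hxy hyz hne]
  grind

lemma edgePred_pathWeight_add_or (hxy : G.Adj x y) (hyz : G.Adj y z) (hne : x ≠ z)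
    (d : V →₀ ℕ) :
    (EdgePred G (pathWeight x y z 2 3 (farVertices G x y z) w)
          (d + (Finsupp.single y 2 + Finsupp.single z 2)) ∨ Finsupp.single x 1 ≤ d) ↔
      EdgePred G (pathWeight x y z 1 2 (farVertices G x y z) w)
        (d + (Finsupp.single y 1 + Finsupp.single z 1)) := by
  classical
  have h1 := hxy.ne
  have h2 := hyz.ne
  have hyF : y ∉ farVertices G x y z := by simp [mem_farVertices]
  have hzF : z ∉ farVertices G x y z := by simp [mem_farVertices]
  rw [Finsupp.single_le_iff, edgePred_pathWeight_iff hxy hyz hne,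
    edgePred_pathWeight_iff hxy hyz hne]
  generalize he : d + (Finsupp.single y 2 + Finsupp.single z 2) = e
  generalize he' : d + (Finsupp.single y 1 + Finsupp.single z 1) = e'
  have hx : e x = d x ∧ e' x = d x := by simp [← he, ← he', h1, hne]
  have hy : e y = d y + 2 ∧ e' y = d y + 1 := by simp [← he, ← he', h2]
  have hz : e z = d z + 2 ∧ e' z = d z + 1 := by simp [← he, ← he', h2.symm]
  have hv : ∀ v, v ∈ farVertices G x y z → e v = e' v := by
    intro v hv
    have h3 : v ≠ y := fun h => hyF (h ▸ hv)
    have h4 : v ≠ z := fun h => hzF (h ▸ hv)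
    simp [← he, ← he', h3, h4]
  have hv' : ∀ v, 1 ≤ e v ↔ 1 ≤ e' v := by
    intro v
    simp only [← he, ← he', Finsupp.add_apply, Finsupp.single_apply]
    split_ifs <;> omega
  have hB : (∃ u ∈ farVertices G x y z, ∃ v ∈ farVertices G x y z,
        G.Adj u v ∧ w u v ≤ e u ∧ w u v ≤ e v) ↔
      ∃ u ∈ farVertices G x y z, ∃ v ∈ farVertices G x y z,
        G.Adj u v ∧ w u v ≤ e' u ∧ w u v ≤ e' v :=
    exists_congr fun u => and_congr_right fun hu => exists_congr fun v =>
      and_congr_right fun h => by rw [hv u hu, hv v h]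
  simp only [hB, hv', hx.1, hx.2, hy.1, hy.2, hz.1, hz.2]
  have h3 : 2 ≤ d x ∧ 2 ≤ d y + 2 → 1 ≤ d x ∧ 1 ≤ d y + 1 := by omega
  have h4 : 3 ≤ d y + 2 ∧ 3 ≤ d z + 2 ↔ 2 ≤ d y + 1 ∧ 2 ≤ d z + 1 := by omega
  rw [h4]
  constructor
  · rintro ((h | h) | h)
    · exact Or.inl (h3 h)
    · exact Or.inr h
    · exact Or.inl ⟨h, by omega⟩
  · rintro (h | h)
    · exact Or.inr h.1
    · exact Or.inl (Or.inr h)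

lemma edgePred_pathWeight_add (hxy : G.Adj x y) (hyz : G.Adj y z) (hxz : ¬G.Adj x z)
    (hne : x ≠ z) (d : V →₀ ℕ) :
    EdgePred G (pathWeight x y z 2 3 (farVertices G x y z) w)
        (d + Finsupp.single x 1 + (Finsupp.single y 2 + Finsupp.single z 2)) ↔
      StatePred G w (farVertices G x y z) (SimpleGraph.fromEdgeSet {s(y, z)})
        {v | v ≠ y ∧ v ≠ z ∧ v ∉ farVertices G x y z} d := by
  classical
  have h1 := hxy.ne
  have h2 := hyz.ne
  have hxF : x ∉ farVertices G x y z := by simp [mem_farVertices]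
  have hyF : y ∉ farVertices G x y z := by simp [mem_farVertices]
  have hzF : z ∉ farVertices G x y z := by simp [mem_farVertices]
  rw [edgePred_pathWeight_iff hxy hyz hne]
  generalize he : d + Finsupp.single x 1 + (Finsupp.single y 2 + Finsupp.single z 2) = e
  have hx : e x = d x + 1 := by simp [← he, h1.symm, hne.symm]
  have hy : e y = d y + 2 := by simp [← he, h1, h2.symm]
  have hz : e z = d z + 2 := by simp [← he, hne, h2]
  have hv : ∀ v, v ≠ x → v ≠ y → v ≠ z → e v = d v := by
    intro v h3 h4 h5
    simp [← he, h3, h4, h5]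
  have hvF : ∀ v, v ∈ farVertices G x y z → e v = d v := fun v h =>
    hv v (fun h' => hxF (h' ▸ h)) (fun h' => hyF (h' ▸ h)) fun h' => hzF (h' ▸ h)
  constructor
  · rintro (h | h | ⟨u, hu, v, hv, huv, h⟩ | ⟨u, v, huv, h3, h4, h5, h, h'⟩)
    · exact Or.inr (Or.inr ⟨x, ⟨h1, hne, hxF⟩, by omega⟩)
    · exact Or.inr (Or.inl ⟨y, z, by simp [h2], show 1 ≤ d y by omega,
        show 1 ≤ d z by omega⟩)
    · rw [hvF u hu, hvF v hv] at h
      exact Or.inl ⟨u, hu, v, hv, huv, h⟩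
    · have key : ∀ v, v ≠ x → v ≠ y → v ≠ z → v ∉ farVertices G x y z → 1 ≤ e v →
          ∃ v ∈ {v | v ≠ y ∧ v ≠ z ∧ v ∉ farVertices G x y z}, 1 ≤ d v :=
        fun v h6 h7 h8 h9 h => ⟨v, ⟨h7, h8, h9⟩, by rwa [hv v h6 h7 h8] at h⟩
      refine Or.inr (Or.inr ?_)
      have huv' := huv.symm
      have := huv.ne
      simp only [ne_eq, Sym2.eq_iff] at h3 h4
      by_cases hu : u = x ∨ u = y ∨ u = z ∨ u ∈ farVertices G x y z
      · have hF : v ∈ farVertices G x y z → u ∈ farVertices G x y z := by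
          rw [mem_farVertices]
          rcases hu with rfl | rfl | rfl | hu
          · exact fun hv' => absurd huv hv'.1.2
          · exact fun hv' => absurd huv hv'.2.1.2
          · exact fun hv' => absurd huv hv'.2.2.2
          · exact fun _ => hu
        refine key v ?_ ?_ ?_ (fun hv' => h5 ⟨hF hv', hv'⟩) h' <;> rintro rfl
        · have : u ∉ farVertices G v y z := fun hu' => (mem_farVertices.1 hu').1.2 huv'
          grind
        · have : u ∉ farVertices G x v z := fun hu' => (mem_farVertices.1 hu').2.1.2 huv'
          grind
        · have : u ∉ farVertices G x y v := fun hu' => (mem_farVertices.1 hu').2.2.2 huv'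
          grind
      · exact key u (by tauto) (by tauto) (by tauto) (by tauto) h
  · rintro (⟨u, hu, v, hv, huv, h⟩ | ⟨u, v, huv, h, h'⟩ | ⟨v, hvA, h⟩)
    · refine Or.inr (Or.inr (Or.inl ⟨u, hu, v, hv, huv, ?_⟩))
      rwa [hvF u hu, hvF v hv]
    · simp at huv
      refine Or.inr (Or.inl ?_)
      grind
    · by_cases hvx : v = x
      · subst hvx
        exact Or.inl (by omega)
      obtain ⟨h3, h4, h5⟩ := hvA
      rw [hv v hvx h3 h4 |>.symm] at h
      refine Or.inr (Or.inr (Or.inr ?_))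
      have h6 : G.Adj x v ∨ G.Adj y v ∨ G.Adj z v := by
        rw [mem_farVertices] at h5
        tauto
      rcases h6 with h6 | h6 | h6
      · exact ⟨x, v, h6, by grind, by grind, by tauto, by omega, h⟩
      · exact ⟨y, v, h6, by grind, by grind, by tauto, by omega, h⟩
      · exact ⟨z, v, h6, by grind, by grind, by tauto, by omega, h⟩

/-- The local cohomology modules of the edge ideals of a graph containing an induced path with two
edges are not all killed by powers of the variable at an end of the path. -/
lemma exists_not_killedAt (hxy : G.Adj x y) (hyz : G.Adj y z) (hxz : ¬G.Adj x z)
    (hne : x ≠ z) :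
    ∃ w : V → V → ℕ, (∀ u v, w u v = w v u) ∧ (∀ u v, 0 < w u v) ∧
      ∃ i : ℕ, (i : WithBot ℕ∞) < ringKrullDim (MvPolynomial V k ⧸ edgeIdealW k G w) ∧
        ¬KilledAt k z i (EdgePred G w) := by
  classical
  by_contra! hcon
  have hN : ∃ N, (∃ T : Finset V, IsIndepSet G T ∧ T.card = N) ∧
      ∀ T : Finset V, IsIndepSet G T → T.card ≤ N := by
    obtain ⟨T, hT, hT'⟩ := (Finset.univ.filter fun T : Finset V => IsIndepSet G T).exists_max_image
      Finset.card ⟨∅, Finset.mem_filter.2 ⟨Finset.mem_univ _, by simp [IsIndepSet]⟩⟩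
    exact ⟨T.card, ⟨T, by simpa using hT, rfl⟩, fun T' h => hT' T' (by simpa using h)⟩
  obtain ⟨N, ⟨T, hT, rfl⟩, hN⟩ := hN
  have hk : ∀ w : V → V → ℕ, (∀ u v, w u v = w v u) → (∀ u v, 0 < w u v) → ∀ i, i < T.card →
      KilledAt k z i (EdgePred G w) := fun w hw hw' i hi => hcon w hw hw' i <|
    lt_of_lt_of_le (by exact_mod_cast hi)
      (card_le_ringKrullDim (edgeIdealW_le_varIdeal hT fun u v _ => hw' u v))
  have hkp : ∀ α β, 0 < α → 0 < β → ∀ w : V → V → ℕ, (∀ u v, w u v = w v u) →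
      (∀ u v, 0 < w u v) → ∀ i, i < T.card →
      KilledAt k z i (EdgePred G (pathWeight x y z α β (farVertices G x y z) w)) :=
    fun α β hα hβ w hw hw' => hk _ (pathWeight_comm hw) (pathWeight_pos hw' hα hβ)
  have hcol : ∀ α β, 0 < α → 0 < β → ∀ w : V → V → ℕ, (∀ u v, w u v = w v u) →
      (∀ u v, 0 < w u v) → ∀ i, i < T.card →
      KilledAt k z i fun d => EdgePred G
        (pathWeight x y z α (β + 1) (farVertices G x y z) w)
        (d + (Finsupp.single y β + Finsupp.single z β)) := by
    intro α β hα hβ w hw hw' i hi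
    refine KilledAt.colon (edgePred_monotone _ _) _
      (hkp α (β + 1) hα β.succ_pos w hw hw' i hi) fun j hj => ?_
    rw [funext fun d => propext (edgePred_pathWeight_or hxy hyz hne d)]
    exact hkp α β hα hβ w hw hw' j (by omega)
  obtain ⟨B, H, A, h, hB, hk'⟩ := (isStage_farVertices hxy hyz hxz hne).exists_killedAt (k := k)
    (N := T.card) fun w hw hw' i hi => by
      rw [← funext fun d => propext (edgePred_pathWeight_add (w := w) hxy hyz hxz hne d)]
      refine KilledAt.colon (p := fun d => EdgePred G
          (pathWeight x y z 2 3 (farVertices G x y z) w)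
          (d + (Finsupp.single y 2 + Finsupp.single z 2)))
        (fun d e hde => edgePred_monotone _ _ (by gcongr)) _
        (hcol 2 2 two_pos two_pos w hw hw' i hi) fun j hj => ?_
      rw [funext fun d => propext (edgePred_pathWeight_add_or (w := w) hxy hyz hne d)]
      exact hcol 1 1 one_pos one_pos w hw hw' j (by omega)
  have hzA : z ∉ A := (h.notMem_of_adj z y h.adj.symm).2
  obtain ⟨R, hzR, hR, hRA, hR'⟩ := exists_indepSet_dominating (H := H) (A := A) (s := {z})
    (by simp [IsIndepSet]) (by simpa using hzA)
  have hzR : z ∈ R := hzR (Finset.mem_singleton_self z)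
  have hxR : x ∉ R := fun h' => hRA x h' h.mem
  have hx : ∀ v ∈ R, ¬G.Adj x v := fun v hv hxv => by
    obtain rfl := h.eq_of_adj v (hRA v hv) hxv
    exact hR v hv z hzR h.adj
  have hxR' : IsIndepSet G (insert x R) := by
    intro u hu v hv huv
    rcases Finset.mem_insert.1 hu with hu | hu <;> rcases Finset.mem_insert.1 hv with hv | hv
    · exact huv.ne (hu.trans hv.symm)
    · exact hx v hv (hu ▸ huv)
    · exact hx u hu (hv ▸ huv.symm)
    · rcases h.adj_or u v (hRA u hu) (hRA v hv) huv with h' | h'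
      · exact hR u hu v hv h'
      · exact hB u h'.1 v h'.2 huv
  have hcard := hN _ hxR'
  rw [Finset.card_insert_of_notMem hxR] at hcard
  exact not_killedAt h.isCliqueUnion (fun u v huv => (h.notMem_of_adj u v huv).2) hR hRA hR' hzA
    (hk' _ hcard)

lemma exists_not_isUnmixedIdeal (hxy : G.Adj x y) (hyz : G.Adj y z) (hxz : ¬G.Adj x z)
    (hne : x ≠ z) :
    ∃ w : V → V → ℕ, (∀ u v, w u v = w v u) ∧ (∀ u v, 0 < w u v) ∧
      ¬IsUnmixedIdeal (edgeIdealW k G w) := by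
  classical
  let w := pathWeight x y z 2 3 (farVertices G x y z) fun _ _ => 1
  have hw' : ∀ u v, 0 < w u v := pathWeight_pos (fun _ _ => one_pos) two_pos three_pos
  refine ⟨w, pathWeight_comm fun _ _ => rfl, hw', fun h => ?_⟩
  obtain ⟨T, -, hT, hTF, hT'⟩ := exists_indepSet_dominating (H := G)
    (A := {v | v ∉ farVertices G x y z}) (s := ∅) (by simp [IsIndepSet]) (by simp)
  have hTF : ∀ r ∈ T, r ∈ farVertices G x y z := fun r hr => not_not.1 (hTF r hr)
  have hzF : z ∉ farVertices G x y z := by simp [mem_farVertices]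
  have hyF : y ∉ farVertices G x y z := by simp [mem_farVertices]
  have hxF : x ∉ farVertices G x y z := by simp [mem_farVertices]
  let u : V →₀ ℕ := Finsupp.equivFunOnFinite.symm fun v => if v ∈ insert z T then 1 else 0
  have hu : ∀ v, u v = if v ∈ insert z T then 1 else 0 := fun v => rfl
  have hF : IsIndepSet G (insert x (insert z T)) := by
    intro a ha b hb hab
    have h1 : ∀ t ∈ T, ¬G.Adj x t ∧ ¬G.Adj z t := fun t ht =>
      ⟨(mem_farVertices.1 (hTF t ht)).1.2, (mem_farVertices.1 (hTF t ht)).2.2.2⟩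
    have h2 := hT a
    have h3 := hab.ne
    have h4 := hab.symm
    simp only [Finset.mem_insert] at ha hb
    rcases ha with rfl | rfl | ha <;> rcases hb with rfl | rfl | hb <;> grind
  have hxF' : x ∉ insert z T := by
    simp only [Finset.mem_insert, not_or]
    exact ⟨hne, fun h => hxF (hTF x h)⟩
  have hcol : ∀ d, EdgePred G w (d + (u + Finsupp.single x 1 +
      (Finsupp.single y 2 + Finsupp.single z 2))) ↔ ∃ v, v ∉ insert z T ∧ 1 ≤ d v := by
    intro d
    rw [← add_assoc d, ← add_assoc d]
    refine (edgePred_pathWeight_add hxy hyz hxz hne _).trans ?_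
    constructor
    · rintro (⟨a, ha, b, hb, hab, h1, h2⟩ | ⟨a, b, hab, h1, h2⟩ | ⟨v, hv, h1⟩)
      · simp only [Finsupp.add_apply, hu] at h1 h2
        by_cases haT : a ∈ T
        · have hbT : b ∉ insert z T := by
            have := hT a haT b
            grind
          exact ⟨b, hbT, by simpa [hbT] using h2⟩
        · have haT : a ∉ insert z T := by grind
          exact ⟨a, haT, by simpa [haT] using h1⟩
      · have hyT : y ∉ insert z T := by
          have := hyz.ne
          grind
        refine ⟨y, hyT, ?_⟩
        simp at hab
        rcases hab.1 with ⟨rfl, rfl⟩ | ⟨rfl, rfl⟩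
        · simpa [hu, hyT] using h1
        · simpa [hu, hyT] using h2
      · have hvT : v ∉ insert z T := by
          have := hv.2
          grind
        exact ⟨v, hvT, by simpa [hu, hvT] using h1⟩
    · rintro ⟨v, hv, h1⟩
      have hle : ∀ v, d v ≤ (d + u) v := fun v => by simp
      by_cases hvF : v ∈ farVertices G x y z
      · obtain ⟨r, hr, hrv⟩ := hT' v (not_not.2 hvF)
        rw [mem_closedNbhd] at hrv
        refine Or.inl ⟨r, hTF r hr, v, hvF, hrv.resolve_left fun h => hv (by grind), ?_,
          h1.trans (hle v)⟩
        simp [hu, hr]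
      · by_cases hvy : v = y
        · subst hvy
          refine Or.inr (Or.inl ⟨v, z, by simp [hyz.ne], h1.trans (hle v), ?_⟩)
          simp [hu]
        · exact Or.inr (Or.inr ⟨v, ⟨hvy, by grind, hvF⟩, h1.trans (hle v)⟩)
  have hass : varIdeal k (insert z T) ∈
      associatedPrimes (MvPolynomial V k) (MvPolynomial V k ⧸ edgeIdealW k G w) := by
    refine AssociatedPrimes.mem_iff.2 (isAssociatedPrime_iff.2 ⟨isPrime_varIdeal, ?_⟩)
    refine ⟨Ideal.Quotient.mk _ (monomial (u + Finsupp.single x 1 +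
      (Finsupp.single y 2 + Finsupp.single z 2)) 1), ?_⟩
    ext f
    rw [Submodule.mem_colon_singleton, Submodule.mem_bot, edgeIdealW_eq]
    change _ ↔ Ideal.Quotient.mk _ (f * _) = 0
    rw [Ideal.Quotient.eq_zero_iff_mem, mul_comm,
      monomial_mul_mem_monIdeal (edgePred_monotone _ _), funext fun d => propext (hcol d)]
    rfl
  have h1 := card_le_ringKrullDim (k := k) (edgeIdealW_le_varIdeal hF fun u v _ => hw' u v)
  rw [← h _ hass, ringKrullDim_quotient_varIdeal, Finset.card_insert_of_notMem hxF'] at h1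
  have h2 : (insert z T).card + 1 ≤ (insert z T).card := by exact_mod_cast h1
  omega

end PathWeight

section Graph

variable {V : Type} {G : SimpleGraph V}

lemma isCliqueUnion_iff :
    IsCliqueUnion G ↔ ∀ u v, G.Reachable u v → u ≠ v → G.Adj u v := by
  constructor
  · rintro h u v ⟨p⟩
    induction p with
    | nil => exact fun h => absurd rfl h
    | @cons a b c hab _ ih =>
      intro hac
      by_cases hbc : b = c
      · exact hbc ▸ hab
      · exact h a b c hab (ih hbc) hac
  · exact fun h u v w huv hvw hne => h u w (huv.reachable.trans hvw.reachable) hne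

lemma exists_of_not_isCliqueUnion (h : ¬IsCliqueUnion G) :
    ∃ x y z, G.Adj x y ∧ G.Adj y z ∧ ¬G.Adj x z ∧ x ≠ z := by
  unfold IsCliqueUnion at h
  push Not at h
  obtain ⟨x, y, z, h1, h2, h3, h4⟩ := h
  exact ⟨x, y, z, h1, h2, h4, h3⟩

end Graph

/-- For a finite simple graph `G`, the following are equivalent:
(1) `I(G,w)` is Cohen-Macaulay for all weight functions `w`;
(2) `I(G,w)` is Buchsbaum for all weight functions `w`;
(3) `I(G,w)` is generalized Cohen-Macaulay for all weight functions `w`;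
(4) `I(G,w)` is unmixed for all weight functions `w`;
(5) `G` is the disjoint union of finitely many complete graphs
    (i.e. every connected component is complete). -/
theorem stmt_16 (k : Type) [Field k] (n : ℕ) (G : SimpleGraph (Fin n)) :
    ((∀ w : Fin n → Fin n → ℕ, (∀ u v, w u v = w v u) → (∀ u v, G.Adj u v → 0 < w u v) →
        IsCMIdeal (maxIdeal k (Fin n)) (edgeIdealW k G w)) ↔
      (∀ u v, G.Reachable u v → u ≠ v → G.Adj u v)) ∧
    ((∀ w : Fin n → Fin n → ℕ, (∀ u v, w u v = w v u) → (∀ u v, G.Adj u v → 0 < w u v) →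
        IsBuchsbaumIdeal (maxIdeal k (Fin n)) (edgeIdealW k G w)) ↔
      (∀ u v, G.Reachable u v → u ≠ v → G.Adj u v)) ∧
    ((∀ w : Fin n → Fin n → ℕ, (∀ u v, w u v = w v u) → (∀ u v, G.Adj u v → 0 < w u v) →
        IsGCMIdeal (maxIdeal k (Fin n)) (edgeIdealW k G w)) ↔
      (∀ u v, G.Reachable u v → u ≠ v → G.Adj u v)) ∧
    ((∀ w : Fin n → Fin n → ℕ, (∀ u v, w u v = w v u) → (∀ u v, G.Adj u v → 0 < w u v) →
        IsUnmixedIdeal (edgeIdealW k G w)) ↔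
      (∀ u v, G.Reachable u v → u ≠ v → G.Adj u v)) := by
  rw [← isCliqueUnion_iff]
  have key : ¬IsCliqueUnion G → ∃ z : Fin n, ∃ w : Fin n → Fin n → ℕ,
      (∀ u v, w u v = w v u) ∧ (∀ u v, G.Adj u v → 0 < w u v) ∧
      ∃ i : ℕ, (i : WithBot ℕ∞) < ringKrullDim (MvPolynomial (Fin n) k ⧸ edgeIdealW k G w) ∧
        ¬∃ s, CohKilledBy (maxIdeal k (Fin n)) (X z ^ s) i
          (ModuleCat.of _ (MvPolynomial (Fin n) k ⧸ edgeIdealW k G w)) := by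
    intro hG
    obtain ⟨x, y, z, hxy, hyz, hxz, hne⟩ := exists_of_not_isCliqueUnion hG
    obtain ⟨w, hw, hw', i, hi, hk⟩ := exists_not_killedAt (k := k) hxy hyz hxz hne
    rw [KilledAt, ← edgeIdealW_eq] at hk
    exact ⟨z, w, hw, fun u v _ => hw' u v, i, hi, hk⟩
  refine ⟨⟨fun h => ?_, fun h w _ hw' => h.isCMIdeal hw'⟩,
    ⟨fun h => ?_, fun h w _ hw' => (h.isCMIdeal hw').isBuchsbaumIdeal⟩,
    ⟨fun h => ?_, fun h w _ hw' => (h.isCMIdeal hw').isGCMIdeal⟩,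
    ⟨fun h => ?_, fun h w hw hw' => h.isUnmixedIdeal hw hw'⟩⟩
  · by_contra hG
    obtain ⟨z, w, hw, hw', i, hi, hk⟩ := key hG
    exact hk ((h w hw hw').exists_cohKilledBy hi)
  · by_contra hG
    obtain ⟨z, w, hw, hw', i, hi, hk⟩ := key hG
    exact hk ((h w hw hw').exists_cohKilledBy (X_mem_maxIdeal z) hi)
  · by_contra hG
    obtain ⟨z, w, hw, hw', i, hi, hk⟩ := key hG
    exact hk ((h w hw hw').exists_cohKilledBy (X_mem_maxIdeal z) hi)
  · by_contra hG
    obtain ⟨x, y, z, hxy, hyz, hxz, hne⟩ := exists_of_not_isCliqueUnion hG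
    obtain ⟨w, hw, hw', hk⟩ := exists_not_isUnmixedIdeal (k := k) hxy hyz hxz hne
    exact hk (h w hw fun u v _ => hw' u v)

end SkewTab
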